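/- arXiv:1412.3129 — 2 statements merged into one kernel-verified Lean document; each statement's English description precedes it below -/
import Mathlib

section
/- Let g satisfy (H), be strictly increasing, and satisfy L_g = g'(0). Let c > c_# (i.e. χ₀(·;c) has two distinct positive real zeros λ₁(c) < λ₂(c)), let φ be a wavefront with speed c, and fix λ ∈ (λ₁(c), λ₂(c)). Suppose w₀ satisfies (IC1), (IC2) and sup_{s∈[−h,0]} |φ(·+cs) − w₀(s,·)|_λ < ∞. Then there exist C > 0 and γ > 0 such that every classical solution u of (*) with initial datum w₀ satisfies sup_{x∈ℝ} |u(t,x) − φ(x+ct)| / η_λ(x+ct) ≤ C e^{−γt} for all t ≥ 0. -/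
open Set Filter

noncomputable section

/-- The weight function `η_λ(t) = min{e^{λt}, 1}`. -/
def eta (lam t : ℝ) : ℝ := min (Real.exp (lam * t)) 1

/-- The characteristic function `χ₀(λ) = λ² − cλ − 1 + g0·e^{−λch}` (with `g0 = g'(0)`). -/
def chi (g0 c h lam : ℝ) : ℝ := lam ^ 2 - c * lam - 1 + g0 * Real.exp (-(lam * c * h))

/-- Hypothesis (H) on the birth function `g` (extended linearly and C¹-smoothly to `(−∞,0]`). -/
structure HypH (g : ℝ → ℝ) (kap del0 Lg : ℝ) : Prop where
  cont : Continuous g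
  nonneg : ∀ x : ℝ, 0 ≤ x → 0 ≤ g x
  kap_pos : 0 < kap
  del0_pos : 0 < del0
  fixed_points : ∀ x : ℝ, 0 ≤ x → (g x = x ↔ x = 0 ∨ x = kap)
  smooth0 : ContDiffOn ℝ 1 g (Set.Ioo (-del0) del0)
  smooth_kap : ContDiffOn ℝ 1 g (Set.Ioo (kap - del0) (kap + del0))
  deriv0_gt : 1 < deriv g 0
  deriv_kap_lt : deriv g kap < 1
  lipschitz : ∀ u v : ℝ, 0 ≤ u → 0 ≤ v → |g u - g v| ≤ Lg * |u - v|
  holder : ∃ C > (0:ℝ), ∃ θ ∈ Set.Ioc (0:ℝ) 1,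
      ∀ u ∈ Set.Ioc (0:ℝ) del0, |deriv g u - deriv g 0| ≤ C * u ^ θ
  ext_linear : ∀ x : ℝ, x ≤ 0 → g x = deriv g 0 * x

/-- (IC1): `0 ≤ w₀ ≤ sup w₀ < ∞` on `Π₀ = [−h,0]×ℝ`. -/
def IC1 (h : ℝ) (w0 : ℝ → ℝ → ℝ) : Prop :=
  ∃ M : ℝ, ∀ s ∈ Set.Icc (-h) 0, ∀ x : ℝ, 0 ≤ w0 s x ∧ w0 s x ≤ M

/-- (IC2): `liminf_{x→+∞} min_{s∈[−h,0]} w₀(s,x) > 0`. -/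
def IC2 (h : ℝ) (w0 : ℝ → ℝ → ℝ) : Prop :=
  ∃ m > (0:ℝ), ∃ X : ℝ, ∀ x ≥ X, ∀ s ∈ Set.Icc (-h) 0, m ≤ w0 s x

/-- `w₀` is locally Hölder continuous in `x`, uniformly in `s ∈ [−h,0]`. -/
def LocHolder (h : ℝ) (w0 : ℝ → ℝ → ℝ) : Prop :=
  ∀ R > (0:ℝ), ∃ K > (0:ℝ), ∃ β ∈ Set.Ioc (0:ℝ) 1,
    ∀ s ∈ Set.Icc (-h) 0, ∀ x ∈ Set.Icc (-R) R, ∀ y ∈ Set.Icc (-R) R,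
      |w0 s x - w0 s y| ≤ K * |x - y| ^ β

/-- A classical solution of the equation (*):
`u_t(t,x) = u_{xx}(t,x) − u(t,x) + g(u(t−h,x))` for `t > 0`, `x ∈ ℝ`. -/
def SolvesStar (g : ℝ → ℝ) (h : ℝ) (u : ℝ → ℝ → ℝ) : Prop :=
  ContinuousOn (fun p : ℝ × ℝ => u p.1 p.2) {p : ℝ × ℝ | -h ≤ p.1} ∧
  (∀ T : ℝ, ∃ M : ℝ, ∀ t ∈ Set.Icc (-h) T, ∀ x : ℝ, |u t x| ≤ M) ∧
  (∀ t : ℝ, 0 < t → ∀ x : ℝ,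
      DifferentiableAt ℝ (fun τ => u τ x) t ∧
      DifferentiableAt ℝ (fun y => u t y) x ∧
      DifferentiableAt ℝ (deriv (fun y => u t y)) x ∧
      deriv (fun τ => u τ x) t =
        deriv (deriv (fun y => u t y)) x - u t x + g (u (t - h) x)) ∧
  ContinuousOn (fun p : ℝ × ℝ => deriv (fun τ => u τ p.2) p.1) {p : ℝ × ℝ | 0 < p.1} ∧
  ContinuousOn (fun p : ℝ × ℝ => deriv (fun y => u p.1 y) p.2) {p : ℝ × ℝ | 0 < p.1} ∧
  ContinuousOn (fun p : ℝ × ℝ => deriv (deriv (fun y => u p.1 y)) p.2) {p : ℝ × ℝ | 0 < p.1}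

/-- A classical solution of equation (E1):
`w_t = w_{zz} − c w_z − w + g(w(t−h, z−ch))` for `t > 0`, `z ∈ ℝ`. -/
def SolvesE1 (g : ℝ → ℝ) (h c : ℝ) (w : ℝ → ℝ → ℝ) : Prop :=
  ContinuousOn (fun p : ℝ × ℝ => w p.1 p.2) {p : ℝ × ℝ | -h ≤ p.1} ∧
  (∀ T : ℝ, ∃ M : ℝ, ∀ t ∈ Set.Icc (-h) T, ∀ z : ℝ, |w t z| ≤ M) ∧
  (∀ t : ℝ, 0 < t → ∀ z : ℝ,
      DifferentiableAt ℝ (fun τ => w τ z) t ∧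
      DifferentiableAt ℝ (fun y => w t y) z ∧
      DifferentiableAt ℝ (deriv (fun y => w t y)) z ∧
      deriv (fun τ => w τ z) t =
        deriv (deriv (fun y => w t y)) z - c * deriv (fun y => w t y) z
          - w t z + g (w (t - h) (z - c * h))) ∧
  ContinuousOn (fun p : ℝ × ℝ => deriv (fun τ => w τ p.2) p.1) {p : ℝ × ℝ | 0 < p.1} ∧
  ContinuousOn (fun p : ℝ × ℝ => deriv (fun y => w p.1 y) p.2) {p : ℝ × ℝ | 0 < p.1} ∧
  ContinuousOn (fun p : ℝ × ℝ => deriv (deriv (fun y => w p.1 y)) p.2) {p : ℝ × ℝ | 0 < p.1}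

/-- A wavefront with speed `c`: a positive bounded C² solution of the profile equation
with `φ(−∞) = 0`, `φ(+∞) = κ`. -/
def IsWavefront (g : ℝ → ℝ) (h c kap : ℝ) (φ : ℝ → ℝ) : Prop :=
  (∀ z : ℝ, 0 < φ z) ∧ (∃ M : ℝ, ∀ z : ℝ, φ z ≤ M) ∧ ContDiff ℝ 2 φ ∧
  (∀ z : ℝ, deriv (deriv φ) z - c * deriv φ z - φ z + g (φ (z - c * h)) = 0) ∧
  Filter.Tendsto φ Filter.atBot (nhds 0) ∧ Filter.Tendsto φ Filter.atTop (nhds kap)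

/-- A semi-wavefront with speed `c`: as a wavefront, but at `+∞` only
`liminf_{z→+∞} φ(z) > 0` is required. -/
def IsSemiWavefront (g : ℝ → ℝ) (h c : ℝ) (φ : ℝ → ℝ) : Prop :=
  (∀ z : ℝ, 0 < φ z) ∧ (∃ M : ℝ, ∀ z : ℝ, φ z ≤ M) ∧ ContDiff ℝ 2 φ ∧
  (∀ z : ℝ, deriv (deriv φ) z - c * deriv φ z - φ z + g (φ (z - c * h)) = 0) ∧
  Filter.Tendsto φ Filter.atBot (nhds 0) ∧
  (∃ m > (0:ℝ), ∀ᶠ z in Filter.atTop, m ≤ φ z)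

/-- The nonlinear operator `𝒩` associated with (E1). -/
def Nop (g : ℝ → ℝ) (h c : ℝ) (w : ℝ → ℝ → ℝ) (t z : ℝ) : ℝ :=
  deriv (fun τ => w τ z) t - deriv (deriv (fun y => w t y)) z
    + c * deriv (fun y => w t y) z + w t z - g (w (t - h) (z - c * h))

/-- A super-solution of (E1) with break point `zs`. -/
def IsSuperSolution (g : ℝ → ℝ) (h c : ℝ) (w : ℝ → ℝ → ℝ) (zs : ℝ) : Prop :=
  ContinuousOn (fun p : ℝ × ℝ => w p.1 p.2) {p : ℝ × ℝ | -h ≤ p.1} ∧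
  (∀ t : ℝ, -h < t → ∀ z : ℝ, DifferentiableAt ℝ (fun τ => w τ z) t) ∧
  (∀ t : ℝ, -h ≤ t → ∀ z : ℝ, z ≠ zs →
      DifferentiableAt ℝ (fun y => w t y) z ∧
      DifferentiableAt ℝ (deriv (fun y => w t y)) z) ∧
  (∀ t : ℝ, 0 < t → ∀ z : ℝ, z ≠ zs → 0 ≤ Nop g h c w t z) ∧
  (∀ t : ℝ, 0 < t →
      derivWithin (fun y => w t y) (Set.Iic zs) zs
        > derivWithin (fun y => w t y) (Set.Ici zs) zs)

/-- A sub-solution of (E1) with break point `zs` (all inequalities reversed). -/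
def IsSubSolution (g : ℝ → ℝ) (h c : ℝ) (w : ℝ → ℝ → ℝ) (zs : ℝ) : Prop :=
  ContinuousOn (fun p : ℝ × ℝ => w p.1 p.2) {p : ℝ × ℝ | -h ≤ p.1} ∧
  (∀ t : ℝ, -h < t → ∀ z : ℝ, DifferentiableAt ℝ (fun τ => w τ z) t) ∧
  (∀ t : ℝ, -h ≤ t → ∀ z : ℝ, z ≠ zs →
      DifferentiableAt ℝ (fun y => w t y) z ∧
      DifferentiableAt ℝ (deriv (fun y => w t y)) z) ∧
  (∀ t : ℝ, 0 < t → ∀ z : ℝ, z ≠ zs → Nop g h c w t z ≤ 0) ∧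
  (∀ t : ℝ, 0 < t →
      derivWithin (fun y => w t y) (Set.Iic zs) zs
        < derivWithin (fun y => w t y) (Set.Ici zs) zs)

/-- At `(t, x)` the function `y` has the partial derivatives `y_t` and `y_xx`, and
`y_t - y_xx + y = r` there. -/
def HasHeatOp (y : ℝ → ℝ → ℝ) (t x r : ℝ) : Prop :=
  ∃ (yt : ℝ) (y' : ℝ → ℝ) (yxx : ℝ), HasDerivAt (fun τ => y τ x) yt t ∧
    (∀ z, HasDerivAt (y t) (y' z) z) ∧ HasDerivAt y' yxx x ∧ yt - yxx + y t x = r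

theorem HasHeatOp.add {y z : ℝ → ℝ → ℝ} {t x r s : ℝ} (hy : HasHeatOp y t x r)
    (hz : HasHeatOp z t x s) : HasHeatOp (fun t x => y t x + z t x) t x (r + s) := by
  obtain ⟨a, b, d, h1, h2, h3, h4⟩ := hy
  obtain ⟨a', b', d', h1', h2', h3', h4'⟩ := hz
  exact ⟨a + a', fun x => b x + b' x, d + d', h1.add h1', fun w => (h2 w).add (h2' w),
    h3.add h3', by rw [← h4, ← h4']; ring⟩

theorem HasHeatOp.neg {y : ℝ → ℝ → ℝ} {t x r : ℝ} (hy : HasHeatOp y t x r) :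
    HasHeatOp (fun t x => -y t x) t x (-r) := by
  obtain ⟨a, b, d, h1, h2, h3, h4⟩ := hy
  exact ⟨-a, fun x => -b x, -d, h1.neg, fun w => (h2 w).neg, h3.neg, by rw [← h4]; ring⟩

theorem HasHeatOp.sub {y z : ℝ → ℝ → ℝ} {t x r s : ℝ} (hy : HasHeatOp y t x r)
    (hz : HasHeatOp z t x s) : HasHeatOp (fun t x => y t x - z t x) t x (r - s) := by
  simpa only [sub_eq_add_neg] using hy.add hz.neg

theorem hasHeatOp_const (A t x : ℝ) : HasHeatOp (fun _ _ => A) t x A :=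
  ⟨0, fun _ => 0, 0, hasDerivAt_const _ _, fun _ => hasDerivAt_const _ _,
    hasDerivAt_const _ _, by ring⟩

theorem hasHeatOp_exp (A α β t x : ℝ) :
    HasHeatOp (fun t x => A * Real.exp (α * t + β * x)) t x
      ((α - β ^ 2 + 1) * (A * Real.exp (α * t + β * x))) := by
  have hx : ∀ (A z : ℝ), HasDerivAt (fun x => A * Real.exp (α * t + β * x))
      (A * β * Real.exp (α * t + β * z)) z := fun A z => by
    exact (((((hasDerivAt_id z).const_mul β).const_add (α * t)).exp).const_mul A).congr_deriv
      (by simp only [id]; ring)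
  have ht : HasDerivAt (fun t => A * Real.exp (α * t + β * x))
      (A * α * Real.exp (α * t + β * x)) t := by
    exact (((((hasDerivAt_id t).const_mul α).add_const (β * x)).exp).const_mul A).congr_deriv
      (by simp only [id]; ring)
  exact ⟨_, _, _, ht, hx A, hx (A * β) x, by ring⟩

/-- Second-order necessary condition for a local minimum. -/
theorem IsLocalMin.second_deriv_nonneg {f f' : ℝ → ℝ} {x d : ℝ} (hmin : IsLocalMin f x)
    (hf : ∀ z, HasDerivAt f (f' z) z) (hf' : HasDerivAt f' d x) : 0 ≤ d := by
  by_contra! hd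
  have hderiv : deriv f = f' := funext fun z => (hf z).deriv
  have hmax : IsLocalMax f x := by
    refine isLocalMax_of_deriv_deriv_neg ?_ hmin.deriv_eq_zero (hf x).continuousAt
    rwa [hderiv, hf'.deriv]
  have hconst : f =ᶠ[nhds x] fun _ => f x := by
    filter_upwards [hmin, hmax] with z h1 h2 using le_antisymm h2 h1
  have h0 : deriv f =ᶠ[nhds x] fun _ => 0 := by
    simpa using hconst.deriv
  have := h0.deriv_eq
  rw [hderiv, hf'.deriv] at this
  simp at this
  linarith

/-- A function that is minimal at `t` among nearby earlier times has nonpositive derivative. -/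
theorem HasDerivAt.nonpos_of_eventually_le_left {f : ℝ → ℝ} {t d : ℝ} (hf : HasDerivAt f d t)
    (hle : ∀ᶠ τ in nhdsWithin t (Iio t), f t ≤ f τ) : d ≤ 0 := by
  have hs := (hasDerivWithinAt_iff_tendsto_slope' (s := Iio t) (by simp)).1 hf.hasDerivWithinAt
  refine le_of_tendsto hs ?_
  filter_upwards [hle, self_mem_nhdsWithin] with τ h1 h2
  rw [slope_def_field]
  exact div_nonpos_of_nonneg_of_nonpos (by linarith) (by linarith [mem_Iio.1 h2])

/-- Weak minimum principle for `y_t - y_xx + y ≥ 0` on a relatively closed space-time region. -/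
theorem nonneg_of_hasHeatOp_nonneg {D E : Set (ℝ × ℝ)} (hD : IsOpen D) (hE : IsClosed E)
    (hDE : D ⊆ E) {y : ℝ → ℝ → ℝ} {t0 t1 B : ℝ}
    (hcont : ContinuousOn (fun p : ℝ × ℝ => y p.1 p.2) {p : ℝ × ℝ | t0 ≤ p.1})
    (hB : ∀ t ∈ Icc t0 t1, ∀ x, (t, x) ∈ E → -B ≤ y t x)
    (hinit : ∀ x, (t0, x) ∈ E → 0 ≤ y t0 x)
    (hbd : ∀ t ∈ Icc t0 t1, ∀ x, (t, x) ∈ E → (t, x) ∉ D → 0 ≤ y t x)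
    (hop : ∀ t ∈ Ioc t0 t1, ∀ x, (t, x) ∈ D → ∃ r, 0 ≤ r ∧ HasHeatOp y t x r) :
    ∀ t ∈ Icc t0 t1, ∀ x, (t, x) ∈ E → 0 ≤ y t x := by
  intro ts hts xs hxs
  by_contra! hneg
  obtain ⟨ε, hε, hεlt⟩ : ∃ ε > 0, y ts xs + ε * (Real.exp xs + Real.exp (-xs)) < 0 := by
    have hp : 0 < Real.exp xs + Real.exp (-xs) := by positivity
    refine ⟨-y ts xs / (2 * (Real.exp xs + Real.exp (-xs))), by apply div_pos <;> linarith, ?_⟩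
    have : -y ts xs / (2 * (Real.exp xs + Real.exp (-xs))) * (Real.exp xs + Real.exp (-xs))
        = -y ts xs / 2 := by field_simp
    linarith
  set Y : ℝ → ℝ → ℝ := fun t x => y t x + ε * (Real.exp x + Real.exp (-x)) with hY
  set R : ℝ := |xs| + |B| / ε with hR
  set K : Set (ℝ × ℝ) := E ∩ (Icc t0 t1 ×ˢ Icc (-R) R) with hK
  have hKc : IsCompact K := (isCompact_Icc.prod isCompact_Icc).inter_left hE
  have hBε : 0 ≤ |B| / ε := by positivity
  have hsK : (ts, xs) ∈ K :=
    ⟨hxs, hts, by constructor <;> [linarith [neg_abs_le xs]; linarith [le_abs_self xs]]⟩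
  have hYc : ContinuousOn (fun p : ℝ × ℝ => Y p.1 p.2) K := by
    refine (hcont.mono fun p hp => hp.2.1.1).add ?_
    fun_prop
  obtain ⟨⟨t, x⟩, ⟨hpE, hpt, hpx⟩, hmin⟩ := hKc.exists_isMinOn ⟨_, hsK⟩ hYc
  have hYneg : Y t x < 0 := lt_of_le_of_lt (hmin hsK) hεlt
  have hψpos : ∀ z : ℝ, 0 < ε * (Real.exp z + Real.exp (-z)) := fun z => by positivity
  have hyneg : y t x < 0 := by have := hψpos x; simp only [hY] at hYneg; linarith
  have hxR : |x| < R := by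
    have h1 : ε * (Real.exp x + Real.exp (-x)) < |B| := by
      have := hB t hpt x hpE
      have := le_abs_self B
      simp only [hY] at hYneg; linarith
    have h2 : |x| < Real.exp x + Real.exp (-x) := by
      rcases abs_cases x with ⟨h, _⟩ | ⟨h, _⟩ <;> rw [h]
      · linarith [Real.add_one_le_exp x, Real.exp_pos (-x)]
      · linarith [Real.add_one_le_exp (-x), Real.exp_pos x]
    have h3 : |x| < |B| / ε := by
      rw [lt_div_iff₀ hε]; nlinarith
    have := abs_nonneg xs
    linarith
  have ht0 : t0 < t := by
    rcases hpt.1.eq_or_lt with h | h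
    · subst h; linarith [hinit x hpE]
    · exact h
  have hpD : (t, x) ∈ D := by
    by_contra h; linarith [hbd t hpt x hpE h]
  obtain ⟨r, hr, yt, y', yxx, h1, h2, h3, h4⟩ : ∃ r, 0 ≤ r ∧ HasHeatOp Y t x r := by
    obtain ⟨r, hr, hop⟩ := hop t ⟨ht0, hpt.2⟩ x hpD
    refine ⟨r, hr, ?_⟩
    have := (hop.add (hasHeatOp_exp ε 0 1 t x)).add (hasHeatOp_exp ε 0 (-1) t x)
    convert this using 1
    · funext t x
      simp only [hY, zero_mul, zero_add, one_mul, neg_mul]; ring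
    · ring
  have hxmin : IsLocalMin (Y t) x := by
    have hDx : ∀ᶠ z in nhds x, (t, z) ∈ D :=
      (Continuous.prodMk_right t).continuousAt.eventually_mem (hD.mem_nhds hpD)
    filter_upwards [hDx, Ioo_mem_nhds (abs_lt.1 hxR).1 (abs_lt.1 hxR).2] with z hz hzR
    exact hmin (show (t, z) ∈ K from ⟨hDE hz, hpt, hzR.1.le, hzR.2.le⟩)
  have htmin : ∀ᶠ τ in nhdsWithin t (Iio t), Y t x ≤ Y τ x := by
    have hDt : ∀ᶠ τ in nhds t, (τ, x) ∈ D :=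
      (Continuous.prodMk_left x).continuousAt.eventually_mem (hD.mem_nhds hpD)
    filter_upwards [nhdsWithin_le_nhds hDt, nhdsWithin_le_nhds (Ioi_mem_nhds ht0),
      self_mem_nhdsWithin] with τ hτ hτ0 hτt
    exact hmin (show (τ, x) ∈ K from
      ⟨hDE hτ, ⟨le_of_lt hτ0, (le_of_lt hτt).trans hpt.2⟩, hpx⟩)
  have := h1.nonpos_of_eventually_le_left htmin
  have := hxmin.second_deriv_nonneg h2 h3
  linarith

/-- Comparison principle, by the method of steps, when the sign of `y_t - y_xx + y` is only known
where the delayed value of `y` is nonnegative. -/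
theorem nonneg_of_delayed_hasHeatOp {D E : Set (ℝ × ℝ)} (hD : IsOpen D) (hE : IsClosed E)
    (hDE : D ⊆ E) {y : ℝ → ℝ → ℝ} {h : ℝ} (hh : 0 < h)
    (hcont : ContinuousOn (fun p : ℝ × ℝ => y p.1 p.2) {p : ℝ × ℝ | -h ≤ p.1})
    (hB : ∀ T : ℝ, ∃ B : ℝ, ∀ t ∈ Icc (-h) T, ∀ x, (t, x) ∈ E → -B ≤ y t x)
    (hinit : ∀ t ∈ Icc (-h) 0, ∀ x, (t, x) ∈ E → 0 ≤ y t x)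
    (hbd : ∀ t, -h ≤ t → ∀ x, (t, x) ∈ E → (t, x) ∉ D → 0 ≤ y t x)
    (hop : ∀ t, 0 < t → ∀ x, (t, x) ∈ D → ((t - h, x) ∈ E → 0 ≤ y (t - h) x) →
      ∃ r, 0 ≤ r ∧ HasHeatOp y t x r) :
    ∀ t, -h ≤ t → ∀ x, (t, x) ∈ E → 0 ≤ y t x := by
  have key : ∀ n : ℕ, ∀ t ∈ Icc (-h) (n * h), ∀ x, (t, x) ∈ E → 0 ≤ y t x := by
    intro n
    induction n with
    | zero => simpa using hinit
    | succ n ih =>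
      intro t ht x hx
      rcases le_total t (n * h) with htn | htn
      · exact ih t ⟨ht.1, htn⟩ x hx
      have hn : 0 ≤ (n : ℝ) * h := by positivity
      have hsucc : ((n + 1 : ℕ) : ℝ) * h = n * h + h := by push_cast; ring
      obtain ⟨B, hB⟩ := hB ((n + 1 : ℕ) * h)
      refine nonneg_of_hasHeatOp_nonneg hD hE hDE (t0 := n * h) (t1 := (n + 1 : ℕ) * h) (B := B)
        (hcont.mono fun p (hp : _ ≤ p.1) => show _ ≤ p.1 by linarith)
        (fun t ht => hB t ⟨by linarith [ht.1], ht.2⟩)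
        (ih _ ⟨by linarith, le_rfl⟩) (fun t ht => hbd t (by linarith [ht.1])) ?_ t ⟨htn, ht.2⟩ x hx
      intro t ht x hx
      refine hop t (by linarith [ht.1]) x hx (ih (t - h) ⟨by linarith [ht.1], ?_⟩ x)
      linarith [ht.2]
  intro t ht x hx
  obtain ⟨n, hn⟩ := exists_nat_ge (t / h)
  exact key n t ⟨ht, (div_le_iff₀ hh).1 hn⟩ x hx

/-- Exponential bound for functions with `|v_t - v_xx + v| ≤ k |v(t - h, x)|`, the left-hand side
having the sign of `v(t - h, x)`. -/
theorem abs_le_exp_of_delayed_hasHeatOp {D E : Set (ℝ × ℝ)} (hD : IsOpen D) (hE : IsClosed E)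
    (hDE : D ⊆ E) {v r : ℝ → ℝ → ℝ} {h k α β B : ℝ} (hh : 0 < h) (hk : 0 ≤ k) (hB : 0 ≤ B)
    (hα : k * Real.exp (-(α * h)) ≤ α - β ^ 2 + 1)
    (hcont : ContinuousOn (fun p : ℝ × ℝ => v p.1 p.2) {p : ℝ × ℝ | -h ≤ p.1})
    (hbdd : ∀ T : ℝ, ∃ M : ℝ, ∀ t ∈ Icc (-h) T, ∀ x, |v t x| ≤ M)
    (hinit : ∀ t ∈ Icc (-h) 0, ∀ x, (t, x) ∈ E → |v t x| ≤ B * Real.exp (α * t + β * x))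
    (hbd : ∀ t, -h ≤ t → ∀ x, (t, x) ∈ E → (t, x) ∉ D →
      |v t x| ≤ B * Real.exp (α * t + β * x))
    (hDh : ∀ t, 0 < t → ∀ x, (t, x) ∈ D → (t - h, x) ∈ E)
    (hop : ∀ t, 0 < t → ∀ x, (t, x) ∈ D → HasHeatOp v t x (r t x))
    (hr : ∀ t, 0 < t → ∀ x, (t, x) ∈ D → |r t x| ≤ k * |v (t - h) x|)
    (hsign : ∀ t, 0 < t → ∀ x, (t, x) ∈ D → 0 ≤ r t x * v (t - h) x) :
    ∀ t, -h ≤ t → ∀ x, (t, x) ∈ E → |v t x| ≤ B * Real.exp (α * t + β * x) := by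
  have one_sided : ∀ v r : ℝ → ℝ → ℝ,
      ContinuousOn (fun p : ℝ × ℝ => v p.1 p.2) {p : ℝ × ℝ | -h ≤ p.1} →
      (∀ T : ℝ, ∃ M : ℝ, ∀ t ∈ Icc (-h) T, ∀ x, |v t x| ≤ M) →
      (∀ t ∈ Icc (-h) 0, ∀ x, (t, x) ∈ E → |v t x| ≤ B * Real.exp (α * t + β * x)) →
      (∀ t, -h ≤ t → ∀ x, (t, x) ∈ E → (t, x) ∉ D → |v t x| ≤ B * Real.exp (α * t + β * x)) →
      (∀ t, 0 < t → ∀ x, (t, x) ∈ D → HasHeatOp v t x (r t x)) →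
      (∀ t, 0 < t → ∀ x, (t, x) ∈ D → |r t x| ≤ k * |v (t - h) x|) →
      (∀ t, 0 < t → ∀ x, (t, x) ∈ D → 0 ≤ r t x * v (t - h) x) →
      ∀ t, -h ≤ t → ∀ x, (t, x) ∈ E → 0 ≤ B * Real.exp (α * t + β * x) - v t x := by
    intro v r hcont hbdd hinit hbd hop hr hsign
    refine nonneg_of_delayed_hasHeatOp hD hE hDE hh ?_ ?_ ?_ ?_ ?_
    · exact ContinuousOn.sub (by fun_prop) hcont
    · intro T
      obtain ⟨M, hM⟩ := hbdd T
      refine ⟨M, fun t ht x _ => ?_⟩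
      have := le_of_abs_le (hM t ht x)
      have : 0 ≤ B * Real.exp (α * t + β * x) := by positivity
      linarith
    · intro t ht x hx
      linarith [le_of_abs_le (hinit t ht x hx)]
    · intro t ht x hx hx'
      linarith [le_of_abs_le (hbd t ht x hx hx')]
    · intro t ht x hx hpast
      refine ⟨_, ?_, (hasHeatOp_exp B α β t x).sub (hop t ht x hx)⟩
      have hpast := hpast (hDh t ht x hx)
      have hshift : k * (B * Real.exp (α * (t - h) + β * x))
          ≤ (α - β ^ 2 + 1) * (B * Real.exp (α * t + β * x)) := by
        have : Real.exp (α * (t - h) + β * x)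
            = Real.exp (-(α * h)) * Real.exp (α * t + β * x) := by
          rw [← Real.exp_add]; congr 1; ring
        rw [this]
        have h0 : 0 ≤ B * Real.exp (α * t + β * x) := by positivity
        nlinarith [mul_le_mul_of_nonneg_right hα h0]
      have h0 : 0 ≤ k * (B * Real.exp (α * (t - h) + β * x)) := by positivity
      have hr := le_of_abs_le (hr t ht x hx)
      have hsign := hsign t ht x hx
      rcases le_or_gt (r t x) 0 with hneg | hpos
      · linarith
      · have hv : 0 ≤ v (t - h) x := nonneg_of_mul_nonneg_right hsign hpos
        rw [abs_of_nonneg hv] at hr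
        have : k * v (t - h) x ≤ k * (B * Real.exp (α * (t - h) + β * x)) :=
          mul_le_mul_of_nonneg_left (by linarith) hk
        linarith
  intro t ht x hx
  have h1 := one_sided v r hcont hbdd hinit hbd hop hr hsign t ht x hx
  have h2 := one_sided (fun t x => -v t x) (fun t x => -r t x) hcont.neg
    (by simpa only [abs_neg] using hbdd) (by simpa only [abs_neg] using hinit)
    (by simpa only [abs_neg] using hbd) (fun t ht x hx => (hop t ht x hx).neg)
    (by simpa only [abs_neg] using hr) (by simpa only [neg_mul_neg] using hsign) t ht x hx
  exact abs_le.2 ⟨by linarith, by linarith⟩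

theorem chi_neg_of_mem_Ioo {p c h lam1 lam2 lam : ℝ} (hp : 0 ≤ p)
    (h1 : chi p c h lam1 = 0) (h2 : chi p c h lam2 = 0) (hlam : lam ∈ Ioo lam1 lam2) :
    chi p c h lam < 0 := by
  obtain ⟨ha, hb⟩ := hlam
  have hd : 0 < lam2 - lam1 := by linarith
  set s := (lam - lam1) / (lam2 - lam1) with hs
  have hs0 : 0 < s := div_pos (by linarith) hd
  have hs1 : 0 < 1 - s := by
    rw [hs, one_sub_div hd.ne']; exact div_pos (by linarith) hd
  have hlam : lam = (1 - s) * lam1 + s * lam2 := by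
    rw [hs]; field_simp; ring
  have hexp := convexOn_exp.2 (mem_univ (-(lam1 * c * h))) (mem_univ (-(lam2 * c * h)))
    hs1.le hs0.le (by ring)
  simp only [smul_eq_mul] at hexp
  have harg : (1 - s) * -(lam1 * c * h) + s * -(lam2 * c * h) = -(lam * c * h) := by
    rw [hlam]; ring
  rw [harg] at hexp
  have hexp := mul_le_mul_of_nonneg_left hexp hp
  unfold chi at *
  have hsq : lam ^ 2 < (1 - s) * lam1 ^ 2 + s * lam2 ^ 2 := by
    have : (1 - s) * lam1 ^ 2 + s * lam2 ^ 2 - lam ^ 2 = s * (1 - s) * (lam2 - lam1) ^ 2 := by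
      rw [hlam]; ring
    have : 0 < s * (1 - s) * (lam2 - lam1) ^ 2 := by positivity
    linarith
  have hlin : c * lam = (1 - s) * (c * lam1) + s * (c * lam2) := by rw [hlam]; ring
  linear_combination hsq + hexp + (1 - s) * h1 + s * h2 - hlin

/-- A strict inequality at rate `0` leaves room for a small exponential rate. -/
theorem exists_pos_rate {a k h : ℝ} (hak : k < a) :
    ∃ γ > 0, k * Real.exp (γ * h) ≤ a - γ := by
  have hc : Tendsto (fun γ : ℝ => a - γ - k * Real.exp (γ * h)) (nhdsWithin 0 (Ioi 0))
      (nhds (a - 0 - k * Real.exp (0 * h))) :=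
    (Continuous.tendsto (by fun_prop) 0).mono_left nhdsWithin_le_nhds
  have hpos : 0 < a - 0 - k * Real.exp (0 * h) := by simpa using hak
  obtain ⟨γ, h1, h2⟩ := ((hc.eventually (lt_mem_nhds hpos)).and self_mem_nhdsWithin).exists
  exact ⟨γ, h2, by linarith⟩

theorem HypH.map_kap {g : ℝ → ℝ} {kap del0 Lg : ℝ} (hH : HypH g kap del0 Lg) : g kap = kap :=
  (hH.fixed_points kap hH.kap_pos.le).2 (Or.inr rfl)

theorem HypH.differentiableAt_kap {g : ℝ → ℝ} {kap del0 Lg : ℝ} (hH : HypH g kap del0 Lg) :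
    DifferentiableAt ℝ g kap :=
  (hH.smooth_kap.contDiffAt (Ioo_mem_nhds (by linarith [hH.del0_pos])
    (by linarith [hH.del0_pos]))).differentiableAt one_ne_zero

/-- The difference quotient of `g` at the fixed point `κ` is less than `1`. -/
theorem HypH.dslope_lt_one {g : ℝ → ℝ} {kap del0 Lg : ℝ} (hH : HypH g kap del0 Lg) {x : ℝ} (hx : 0 < x) : dslope g kap x < 1 := by
  by_contra! hge
  have hcont : ContinuousOn (dslope g kap) (Ioi 0) :=
    (continuousOn_dslope (Ioi_mem_nhds hH.kap_pos)).2 ⟨hH.cont.continuousOn, hH.differentiableAt_kap⟩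
  have hk : dslope g kap kap < 1 := by rw [dslope_same]; exact hH.deriv_kap_lt
  obtain ⟨z, hz, hz1⟩ := isPreconnected_Ioi.intermediate_value hH.kap_pos hx hcont ⟨hk.le, hge⟩
  have hz0 : 0 < z := hz
  have hs := sub_smul_dslope g kap z
  rw [hz1, smul_eq_mul, mul_one, hH.map_kap] at hs
  rcases (hH.fixed_points z hz0.le).1 (by linarith) with h | h
  · exact hz0.ne' h
  · rw [h] at hz1; exact hk.ne hz1

/-- `g` contracts `[m, M]` towards the fixed point `κ`. -/
theorem HypH.contraction_fixed_point {g : ℝ → ℝ} {kap del0 Lg : ℝ} (hH : HypH g kap del0 Lg)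
    (hmono : StrictMono g) {m M : ℝ} (hm : 0 < m) :
    ∃ k, 0 ≤ k ∧ k < 1 ∧ ∀ x ∈ Icc m M, |g x - kap| ≤ k * |x - kap| := by
  rcases (Icc m M).eq_empty_or_nonempty with he | hne
  · exact ⟨0, le_rfl, one_pos, by simp [he]⟩
  have hcont : ContinuousOn (dslope g kap) (Icc m M) :=
    ((continuousOn_dslope (Ioi_mem_nhds hH.kap_pos)).2 ⟨hH.cont.continuousOn, hH.differentiableAt_kap⟩).mono
      fun x hx => lt_of_lt_of_le hm hx.1
  obtain ⟨z, hz, hmax⟩ := isCompact_Icc.exists_isMaxOn hne hcont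
  have hnn : ∀ x, 0 ≤ dslope g kap x := fun x => by
    rcases eq_or_ne x kap with rfl | hx
    · rw [dslope_same]; exact hmono.monotone.deriv_nonneg
    · rw [dslope_of_ne _ hx, slope_def_field]
      rcases lt_or_gt_of_ne hx with h | h
      · exact div_nonneg_of_nonpos (by linarith [hmono h]) (by linarith)
      · exact div_nonneg (by linarith [hmono h]) (by linarith)
  refine ⟨_, hnn z, hH.dslope_lt_one (lt_of_lt_of_le hm hz.1), fun x hx => ?_⟩
  have hs := sub_smul_dslope g kap x
  rw [smul_eq_mul, hH.map_kap] at hs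
  rw [← hs, abs_mul, mul_comm, abs_of_nonneg (hnn x)]
  exact mul_le_mul_of_nonneg_right (hmax hx) (abs_nonneg _)

/-- `g` contracts distances between points of `[m, M]` and points close to `κ`. -/
theorem HypH.contraction {g : ℝ → ℝ} {kap del0 Lg : ℝ} (hH : HypH g kap del0 Lg)
    (hmono : StrictMono g) {m M : ℝ} (hm : 0 < m) :
    ∃ ε > 0, ∃ k, 0 ≤ k ∧ k < 1 ∧
      ∀ x ∈ Icc m M, ∀ y, |y - kap| ≤ ε → |g x - g y| ≤ k * |x - y| := by
  have hstrict : HasStrictDerivAt g (deriv g kap) kap := by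
    refine ContDiffAt.hasStrictDerivAt (n := 1) (hH.smooth_kap.contDiffAt ?_) one_ne_zero
    exact Ioo_mem_nhds (by linarith [hH.del0_pos]) (by linarith [hH.del0_pos])
  obtain ⟨k0, hk0, hk01, hfix⟩ := hH.contraction_fixed_point hmono hm (M := M)
  obtain ⟨k1, hk1, hk11⟩ := exists_between hH.deriv_kap_lt
  have hk10 : 0 ≤ k1 := hmono.monotone.deriv_nonneg.trans hk1.le
  lift k1 to NNReal using hk10
  obtain ⟨s, hs, hlip⟩ := hstrict.hasStrictFDerivAt.exists_lipschitzOnWith_of_nnnorm_lt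
    k1 (by
      rw [← NNReal.coe_lt_coe]
      simpa [abs_of_nonneg (hmono.monotone.deriv_nonneg (x := kap))] using hk1)
  have hlip : ∀ x ∈ s, ∀ y ∈ s, |g x - g y| ≤ (k1 : ℝ) * |x - y| := fun x hx y hy => by
    simpa [Real.dist_eq] using hlip.dist_le_mul x hx y hy
  obtain ⟨δ, hδ, hball⟩ := Metric.mem_nhds_iff.1 hs
  have hball : ∀ x, |x - kap| < δ → x ∈ s := fun x hx => hball (by simpa [Real.dist_eq] using hx)
  have hks : kap ∈ s := hball kap (by simpa using hδ)
  refine ⟨δ * (1 - k0) / 8, by apply div_pos (mul_pos hδ (by linarith)); norm_num,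
    max (k1 : ℝ) ((1 + k0) / 2), le_max_of_le_left k1.2, max_lt hk11 (by linarith), ?_⟩
  intro x hx y hy
  have hyδ : |y - kap| ≤ δ / 8 := hy.trans (by nlinarith)
  have hys : y ∈ s := hball y (by linarith)
  rcases lt_or_ge |x - kap| δ with hxδ | hxδ
  · exact (hlip x (hball x hxδ) y hys).trans
      (mul_le_mul_of_nonneg_right (le_max_left _ _) (abs_nonneg _))
  · refine le_trans ?_ (mul_le_mul_of_nonneg_right (le_max_right _ _) (abs_nonneg _))
    have h1 := hfix x hx
    have h2 := hlip y hys kap hks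
    rw [hH.map_kap] at h2
    have h3 : |g x - g y| ≤ |g x - kap| + |g y - kap| := by
      simpa [abs_sub_comm] using abs_sub_le (g x) kap (g y)
    have h4 : |x - kap| ≤ |x - y| + |y - kap| := abs_sub_le x y kap
    have h5 : (k1 : ℝ) * |y - kap| ≤ |y - kap| := by nlinarith [abs_nonneg (y - kap)]
    have h6 : k0 * |x - kap| ≤ k0 * |x - y| + |y - kap| := by
      nlinarith [abs_nonneg (y - kap), mul_le_mul_of_nonneg_left h4 hk0]
    have h7 : (1 - k0) * (δ / 2) ≤ (1 - k0) * |x - y| :=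
      mul_le_mul_of_nonneg_left (by linarith) (by linarith)
    linarith

theorem HypH.map_le_self {g : ℝ → ℝ} {kap del0 Lg : ℝ} (hH : HypH g kap del0 Lg) {x : ℝ}
    (hx : kap ≤ x) : g x ≤ x := by
  have hs := sub_smul_dslope g kap x
  rw [smul_eq_mul, hH.map_kap] at hs
  nlinarith [hH.dslope_lt_one (lt_of_lt_of_le hH.kap_pos hx)]

theorem HypH.self_le_map {g : ℝ → ℝ} {kap del0 Lg : ℝ} (hH : HypH g kap del0 Lg) {x : ℝ}
    (hx0 : 0 < x) (hx : x ≤ kap) : x ≤ g x := by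
  have hs := sub_smul_dslope g kap x
  rw [smul_eq_mul, hH.map_kap] at hs
  nlinarith [hH.dslope_lt_one hx0]

theorem SolvesStar.hasHeatOp {g : ℝ → ℝ} {h : ℝ} {u : ℝ → ℝ → ℝ} (hu : SolvesStar g h u)
    {t : ℝ} (ht : 0 < t) (x : ℝ) : HasHeatOp u t x (g (u (t - h) x)) := by
  obtain ⟨h1, -, h3, h4⟩ := hu.2.2.1 t ht x
  exact ⟨_, _, _, h1.hasDerivAt, fun z => (hu.2.2.1 t ht z).2.1.hasDerivAt, h3.hasDerivAt,
    by rw [h4]; ring⟩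

theorem IsWavefront.hasHeatOp {g : ℝ → ℝ} {h c kap : ℝ} {φ : ℝ → ℝ}
    (hφ : IsWavefront g h c kap φ) (t x : ℝ) :
    HasHeatOp (fun t x => φ (x + c * t)) t x (g (φ (x + c * (t - h)))) := by
  obtain ⟨-, -, hC, heq, -, -⟩ := hφ
  have h1 : ∀ z, HasDerivAt φ (deriv φ z) z := fun z =>
    (hC.differentiable two_ne_zero z).hasDerivAt
  have h2 : ∀ z, HasDerivAt (deriv φ) (deriv (deriv φ) z) z := fun z =>
    (hC.differentiable_deriv_two z).hasDerivAt
  refine ⟨deriv φ (x + c * t) * c, fun z => deriv φ (z + c * t), deriv (deriv φ) (x + c * t),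
    ?_, fun z => (h1 _).comp_add_const _ _, (h2 _).comp_add_const _ _, ?_⟩
  · have hin : HasDerivAt (fun τ => x + c * τ) c t := by
      simpa using ((hasDerivAt_id t).const_mul c).const_add x
    exact (h1 _).comp t hin
  · have := heq (x + c * t)
    rw [show x + c * (t - h) = x + c * t - c * h by ring]
    linarith

theorem SolvesStar.nonneg {g : ℝ → ℝ} {h : ℝ} {u : ℝ → ℝ → ℝ} (hu : SolvesStar g h u)
    (hh : 0 < h) (hg : ∀ x, 0 ≤ x → 0 ≤ g x) (hinit : ∀ t ∈ Icc (-h) 0, ∀ x, 0 ≤ u t x)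
    {t : ℝ} (ht : -h ≤ t) (x : ℝ) : 0 ≤ u t x := by
  refine nonneg_of_delayed_hasHeatOp isOpen_univ isClosed_univ subset_rfl hh hu.1 ?_
    (fun t ht x _ => hinit t ht x) (by simp)
    (fun t ht x _ hp => ⟨_, hg _ (hp trivial), hu.hasHeatOp ht x⟩) t ht x trivial
  intro T
  obtain ⟨M, hM⟩ := hu.2.1 T
  exact ⟨M, fun t ht x _ => (abs_le.1 (hM t ht x)).1⟩

theorem SolvesStar.le_const {g : ℝ → ℝ} {h M : ℝ} {u : ℝ → ℝ → ℝ} (hu : SolvesStar g h u)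
    (hh : 0 < h) (hg : Monotone g) (hM : g M ≤ M) (hinit : ∀ t ∈ Icc (-h) 0, ∀ x, u t x ≤ M)
    {t : ℝ} (ht : -h ≤ t) (x : ℝ) : u t x ≤ M := by
  have := nonneg_of_delayed_hasHeatOp (y := fun t x => M - u t x) isOpen_univ isClosed_univ
    subset_rfl hh (continuousOn_const.sub hu.1) ?_
    (fun t ht x _ => by linarith [hinit t ht x]) (by simp)
    (fun t ht x _ hp => ⟨_, ?_, (hasHeatOp_const M t x).sub (hu.hasHeatOp ht x)⟩) t ht x trivial
  · linarith
  · intro T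
    obtain ⟨M', hM'⟩ := hu.2.1 T
    exact ⟨M' - M, fun t ht x _ => by linarith [(abs_le.1 (hM' t ht x)).2]⟩
  · have : g (u (t - h) x) ≤ g M := hg (by linarith [hp trivial])
    linarith

theorem isOpen_movingHalfPlane (c Z : ℝ) : IsOpen {p : ℝ × ℝ | Z < p.2 + c * p.1} :=
  isOpen_lt (by fun_prop) (by fun_prop)

theorem isClosed_movingHalfPlane (c Z : ℝ) : IsClosed {p : ℝ × ℝ | Z ≤ p.2 + c * p.1} :=
  isClosed_le (by fun_prop) (by fun_prop)

/-- A nonnegative supersolution that starts above `m` on a half-line stays uniformly positive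
there on bounded time intervals, in the frame moving with speed `-c`. -/
theorem exists_pos_lower_bound {u r : ℝ → ℝ → ℝ} {h c m Z T : ℝ} (hh : 0 < h) (hc : 0 < c)
    (hm : 0 < m) (hcont : ContinuousOn (fun p : ℝ × ℝ => u p.1 p.2) {p : ℝ × ℝ | -h ≤ p.1})
    (hu : ∀ t, -h ≤ t → ∀ x, 0 ≤ u t x) (hr : ∀ t, 0 < t → ∀ x, 0 ≤ r t x)
    (hop : ∀ t, 0 < t → ∀ x, HasHeatOp u t x (r t x))
    (hinit : ∀ t ∈ Icc (-h) 0, ∀ x, Z ≤ x + c * t → m ≤ u t x) :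
    ∃ m' > 0, ∀ t ∈ Icc (-h) T, ∀ x, Z + 1 ≤ x + c * t → m' ≤ u t x := by
  set a : ℝ := (3 + c) ^ 2 / 2 + 1 with ha
  have ha0 : 0 < a := by positivity
  set S : ℝ → ℝ → ℝ := fun t x =>
    m * Real.exp (-(a * (t + h))) * (1 - Real.exp (-(x + c * t - Z))) ^ 2 with hS
  have hSop : ∀ t x, HasHeatOp S t x (-(m * Real.exp (-(a * (t + h))) *
      ((a - 1) - 2 * (a + c) * Real.exp (-(x + c * t - Z))
        + (a + 2 * c + 3) * Real.exp (-(x + c * t - Z)) ^ 2))) := by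
    intro t x
    have h0 : ∀ t x : ℝ, m * Real.exp (-(a * (t + h)))
        = m * Real.exp (-(a * h)) * Real.exp (-a * t + 0 * x) := fun t x => by
      rw [mul_assoc, ← Real.exp_add]; ring_nf
    have h1 : ∀ t x : ℝ, m * Real.exp (-(a * (t + h))) * Real.exp (-(x + c * t - Z))
        = m * Real.exp (-(a * h) + Z) * Real.exp ((-a - c) * t + (-1) * x) := fun t x => by
      rw [mul_assoc, mul_assoc, ← Real.exp_add, ← Real.exp_add]; ring_nf
    have h2 : ∀ t x : ℝ, m * Real.exp (-(a * (t + h))) * Real.exp (-(x + c * t - Z)) ^ 2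
        = m * Real.exp (-(a * h) + 2 * Z) * Real.exp ((-a - 2 * c) * t + (-2) * x) :=
      fun t x => by
        rw [mul_assoc, mul_assoc, pow_two, ← Real.exp_add, ← Real.exp_add, ← Real.exp_add]
        ring_nf
    have e1 := hasHeatOp_exp (m * Real.exp (-(a * h) + Z)) (-a - c) (-1) t x
    have := (((hasHeatOp_exp (m * Real.exp (-(a * h))) (-a) 0 t x).sub e1).sub e1).add
      (hasHeatOp_exp (m * Real.exp (-(a * h) + 2 * Z)) (-a - 2 * c) (-2) t x)
    convert this using 1
    · funext t x
      simp only [hS]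
      rw [← h0, ← h1, ← h2]; ring
    · rw [← h0, ← h1, ← h2]; ring
  have hSle : ∀ t, -h ≤ t → ∀ x, Z ≤ x + c * t → S t x ≤ m := by
    intro t ht x hx
    have h1 : Real.exp (-(a * (t + h))) ≤ 1 := Real.exp_le_one_iff.2 (by nlinarith)
    have h2 : Real.exp (-(x + c * t - Z)) ≤ 1 := Real.exp_le_one_iff.2 (by linarith)
    have h3 : (1 - Real.exp (-(x + c * t - Z))) ^ 2 ≤ 1 :=
      pow_le_one₀ (by linarith) (by linarith [Real.exp_pos (-(x + c * t - Z))])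
    have h4 : m * Real.exp (-(a * (t + h))) ≤ m := by nlinarith
    calc S t x ≤ m * 1 := mul_le_mul h4 h3 (by positivity) hm.le
      _ = m := mul_one m
  have hcmp := nonneg_of_delayed_hasHeatOp (y := fun t x => u t x - S t x)
    (isOpen_movingHalfPlane c Z) (isClosed_movingHalfPlane c Z) 
    (fun p (hp : Z < p.2 + c * p.1) => hp.le) hh
    (hcont.sub (by fun_prop)) ?_ ?_ ?_ ?_
  · refine ⟨m * Real.exp (-(a * (T + h))) * (1 - Real.exp (-1)) ^ 2, ?_, ?_⟩
    · have : Real.exp (-1) < 1 := by simp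
      have : 0 < 1 - Real.exp (-1) := by linarith
      positivity
    · intro t ht x hx
      have h0 := hcmp t ht.1 x (show Z ≤ x + c * t by linarith)
      have h1 : Real.exp (-(a * (T + h))) ≤ Real.exp (-(a * (t + h))) :=
        Real.exp_le_exp.2 (by nlinarith [ht.2])
      have h2 : Real.exp (-(x + c * t - Z)) ≤ Real.exp (-1) :=
        Real.exp_le_exp.2 (by linarith)
      have h3 : Real.exp (-1) < 1 := by simp
      have : m * Real.exp (-(a * (T + h))) * (1 - Real.exp (-1)) ^ 2 ≤ S t x := by
        simp only [hS]
        gcongr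
      linarith
  · exact fun T => ⟨m, fun t ht x hx => by linarith [hSle t ht.1 x hx, hu t ht.1 x]⟩
  · exact fun t ht x hx => by linarith [hSle t ht.1 x hx, hinit t ht x hx]
  · intro t ht x hx hx'
    have hZ : x + c * t - Z = 0 := by
      have h1 : Z ≤ x + c * t := hx
      have h2 : ¬ Z < x + c * t := hx'
      linarith
    have : S t x = 0 := by simp only [hS]; rw [hZ]; simp
    linarith [hu t ht x]
  · intro t ht x hx _
    refine ⟨_, ?_, (hop t ht x).sub (hSop t x)⟩
    set s := Real.exp (-(x + c * t - Z))
    have : 0 ≤ (a - 1) - 2 * (a + c) * s + (a + 2 * c + 3) * s ^ 2 := by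
      have : (a - 1) - 2 * (a + c) * s + (a + 2 * c + 3) * s ^ 2
          = 2 * (1 - (3 + c) / 2 * (1 - s)) ^ 2 + (2 * c + 4) * (1 - s) ^ 2 := by
        rw [ha]; ring
      rw [this]; positivity
    have h1 : 0 ≤ m * Real.exp (-(a * (t + h))) *
        ((a - 1) - 2 * (a + c) * s + (a + 2 * c + 3) * s ^ 2) := by positivity
    linarith [hr t ht x]

/-- **Theorem 2B (global exponential stability of non-critical fronts).**
With `L_g = g'(0)`, `g` strictly increasing, `c > c_#`, `λ ∈ (λ₁(c),λ₂(c))` and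
a finite `|·|_λ` initial perturbation, the solution converges to the front at an
exponential rate in the `η_λ`-weighted uniform norm. -/
theorem exponential_stability_noncritical
    (g : ℝ → ℝ) (kap del0 Lg h c : ℝ)
    (hH : HypH g kap del0 Lg) (hmono : StrictMono g)
    (hLg : Lg = deriv g 0)
    (hh : 0 < h) (hc : 0 < c)
    -- c > c_# : χ₀(·;c) has two distinct positive real zeros λ₁ < λ₂
    (lam1 lam2 : ℝ) (hlam1_pos : 0 < lam1) (hlam_lt : lam1 < lam2)
    (hchi1 : chi (deriv g 0) c h lam1 = 0) (hchi2 : chi (deriv g 0) c h lam2 = 0)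
    (φ : ℝ → ℝ) (hφ : IsWavefront g h c kap φ)
    (lam : ℝ) (hlam : lam ∈ Set.Ioo lam1 lam2)
    (w0 : ℝ → ℝ → ℝ) (hIC1 : IC1 h w0) (hIC2 : IC2 h w0) (hHol : LocHolder h w0)
    -- sup_{s∈[−h,0]} |φ(·+cs) − w₀(s,·)|_λ < ∞
    (hpert : ∃ M : ℝ, ∀ s ∈ Set.Icc (-h) 0, ∀ x : ℝ,
        |φ (x + c * s) - w0 s x| ≤ M * eta lam x)
    -- u : a classical solution of (*) with initial datum w₀
    (u : ℝ → ℝ → ℝ) (hu : SolvesStar g h u)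
    (hinit : ∀ s ∈ Set.Icc (-h) 0, ∀ x : ℝ, u s x = w0 s x) :
    ∃ C > (0:ℝ), ∃ γ > (0:ℝ), ∀ t ≥ (0:ℝ), ∀ x : ℝ,
      |u t x - φ (x + c * t)| ≤ C * Real.exp (-(γ * t)) * eta lam (x + c * t) := by
  have hp : 0 ≤ Lg := by rw [hLg]; linarith [hH.deriv0_gt]
  have hlam0 : 0 < lam := hlam1_pos.trans hlam.1
  obtain ⟨M0, hM0⟩ := hIC1
  obtain ⟨m0, hm0, X, hX⟩ := hIC2
  obtain ⟨M1, hM1⟩ := hpert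
  obtain ⟨hφpos, ⟨Mφ, hMφ⟩, hφC, -, -, hφtop⟩ := id hφ
  have hφcont : Continuous φ := hφC.continuous
  have hu0 : ∀ t, -h ≤ t → ∀ x, 0 ≤ u t x := fun t ht x =>
    hu.nonneg hh hH.nonneg (fun t ht x => by rw [hinit t ht x]; exact (hM0 t ht x).1) ht x
  have huM : ∀ t, -h ≤ t → ∀ x, u t x ≤ max M0 kap := fun t ht x =>
    hu.le_const hh hmono.monotone (hH.map_le_self (le_max_right _ _))
      (fun t ht x => by rw [hinit t ht x]; exact (hM0 t ht x).2.trans (le_max_left _ _)) ht x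
  set v : ℝ → ℝ → ℝ := fun t x => u t x - φ (x + c * t) with hv
  set r : ℝ → ℝ → ℝ := fun t x => g (u (t - h) x) - g (φ (x + c * (t - h))) with hr
  have hvop : ∀ t, 0 < t → ∀ x, HasHeatOp v t x (r t x) := fun t ht x =>
    (hu.hasHeatOp ht x).sub (hφ.hasHeatOp t x)
  have hvcont : ContinuousOn (fun p : ℝ × ℝ => v p.1 p.2) {p : ℝ × ℝ | -h ≤ p.1} :=
    hu.1.sub (by fun_prop)
  have hvbdd : ∀ T : ℝ, ∃ M : ℝ, ∀ t ∈ Icc (-h) T, ∀ x, |v t x| ≤ M := fun T =>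
    ⟨max M0 kap + Mφ, fun t ht x => abs_le.2
      ⟨by simp only [hv]; linarith [hu0 t ht.1 x, hMφ (x + c * t), hφpos (x + c * t),
          (hu0 t ht.1 x).trans (huM t ht.1 x)],
        by simp only [hv]; linarith [huM t ht.1 x, hφpos (x + c * t), hMφ (x + c * t)]⟩⟩
  have hsign : ∀ t x, 0 ≤ r t x * v (t - h) x := fun t x => by
    simp only [hr, hv]
    rcases le_total (u (t - h) x) (φ (x + c * (t - h))) with hle | hle
    · exact mul_nonneg_of_nonpos_of_nonpos (by linarith [hmono.monotone hle]) (by linarith)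
    · exact mul_nonneg (by linarith [hmono.monotone hle]) (by linarith)
  obtain ⟨A, hA, hv0⟩ : ∃ A, 0 ≤ A ∧ ∀ t ∈ Icc (-h) 0, ∀ x,
      |v t x| ≤ A * eta lam (x + c * t) := by
    refine ⟨|M1| * Real.exp (lam * (c * h)), by positivity, fun t ht x => ?_⟩
    have hη : 0 ≤ eta lam x := le_min (Real.exp_pos _).le zero_le_one
    have hshift : eta lam x ≤ Real.exp (lam * (c * h)) * eta lam (x + c * t) := by
      have hct : 0 ≤ c * (h + t) := mul_nonneg hc.le (by linarith [ht.1])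
      unfold eta
      rw [mul_min_of_nonneg _ _ (Real.exp_pos _).le, ← Real.exp_add, mul_one]
      refine min_le_min (Real.exp_le_exp.2 ?_) (Real.one_le_exp (by positivity))
      nlinarith [mul_nonneg hlam0.le hct]
    simp only [hv]
    rw [hinit t ht x, abs_sub_comm, mul_assoc]
    exact (hM1 t ht x).trans ((mul_le_mul_of_nonneg_right (le_abs_self M1) hη).trans
      (mul_le_mul_of_nonneg_left hshift (abs_nonneg M1)))
  -- decay in the exponentially weighted norm on the whole line
  obtain ⟨γ, hγ, hγle⟩ : ∃ γ > 0, Lg * Real.exp (-(lam * c * h)) * Real.exp (γ * h)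
      ≤ (lam * c - lam ^ 2 + 1) - γ := by
    refine exists_pos_rate ?_
    have := chi_neg_of_mem_Ioo (hLg ▸ hp) hchi1 hchi2 hlam
    rw [← hLg] at this
    unfold chi at this
    linarith
  have hweight : ∀ t, -h ≤ t → ∀ x,
      |v t x| ≤ A * Real.exp (-(γ * t)) * Real.exp (lam * (x + c * t)) := by
    have hsplit : ∀ t x : ℝ, A * Real.exp (-(γ * t)) * Real.exp (lam * (x + c * t))
        = A * Real.exp ((lam * c - γ) * t + lam * x) := fun t x => by
      rw [mul_assoc, ← Real.exp_add]; ring_nf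
    intro t ht x
    rw [hsplit]
    refine abs_le_exp_of_delayed_hasHeatOp (r := r) (k := Lg) isOpen_univ isClosed_univ subset_rfl
      hh hp (hA) ?_ hvcont hvbdd ?_ (by simp) (by simp) (fun t ht x _ => hvop t ht x)
      ?_ (fun t _ x _ => hsign t x) t ht x trivial
    · rw [mul_assoc, ← Real.exp_add] at hγle
      convert hγle using 1
      · ring_nf
      · ring
    · intro t ht x _
      rw [← hsplit, mul_assoc]
      refine (hv0 t ht x).trans (mul_le_mul_of_nonneg_left ?_ (hA))
      refine (min_le_left _ _).trans (le_mul_of_one_le_left (Real.exp_pos _).le ?_)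
      exact Real.one_le_exp (by nlinarith [ht.2])
    · exact fun t ht x _ => hH.lipschitz _ _ (hu0 _ (by linarith) x) (hφpos _).le
  -- uniform positivity ahead of the front
  obtain ⟨Z0, hZ0⟩ := Filter.eventually_atTop.1
    ((hφtop.eventually (lt_mem_nhds (half_lt_self hH.kap_pos))).and (eventually_ge_atTop X))
  obtain ⟨m, hm, Z1, hZ1⟩ : ∃ m > 0, ∃ Z1, ∀ t, -h ≤ t → ∀ x, Z1 ≤ x + c * t → m ≤ u t x := by
    obtain ⟨T, hT0, hT⟩ : ∃ T, 0 ≤ T ∧ ∀ t, T ≤ t →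
        A * Real.exp (-(γ * t)) * Real.exp (lam * (Z0 + 1 + c * h)) ≤ kap / 4 := by
      have hlim : Tendsto
          (fun t => A * Real.exp (-(γ * t)) * Real.exp (lam * (Z0 + 1 + c * h))) atTop
          (nhds (A * 0 * Real.exp (lam * (Z0 + 1 + c * h)))) :=
        ((Real.tendsto_exp_neg_atTop_nhds_zero.comp
          (tendsto_id.const_mul_atTop hγ)).const_mul _).mul_const _
      have hlim := hlim.eventually_lt_const (u := kap / 4)
        (by rw [mul_zero, zero_mul]; linarith [hH.kap_pos])
      obtain ⟨T, hT⟩ := Filter.eventually_atTop.1 hlim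
      exact ⟨max T 0, le_max_right _ _, fun t ht => (hT t (le_trans (le_max_left _ _) ht)).le⟩
    obtain ⟨m', hm', hlow⟩ := exists_pos_lower_bound (T := T) (Z := Z0) hh hc hm0 hu.1 hu0
      (r := fun t x => g (u (t - h) x)) (fun t ht x => hH.nonneg _ (hu0 _ (by linarith) x))
      (fun t ht x => hu.hasHeatOp ht x) (fun t ht x hx => by
        rw [hinit t ht x]
        exact hX x (by nlinarith [ht.2, (hZ0 Z0 le_rfl).2]) t ht)
    have hmin : 0 < min m' (kap / 4) := lt_min hm' (by linarith [hH.kap_pos])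
    refine ⟨min m' (kap / 4), hmin, Z0 + 1, ?_⟩
    have hcmp := nonneg_of_delayed_hasHeatOp (y := fun t x => u t x - min m' (kap / 4))
      (isOpen_movingHalfPlane c (Z0 + 1 + c * h)) (isClosed_movingHalfPlane c (Z0 + 1))
      (fun p (hp : Z0 + 1 + c * h < p.2 + c * p.1) => show Z0 + 1 ≤ p.2 + c * p.1 by
        nlinarith) hh (hu.1.sub continuousOn_const) ?_ ?_ ?_ ?_
    · exact fun t ht x hx => by linarith [hcmp t ht x hx]
    · exact fun T => ⟨min m' (kap / 4), fun t ht x _ => by linarith [hu0 t ht.1 x]⟩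
    · exact fun t ht x hx => by
        linarith [hlow t ⟨ht.1, ht.2.trans hT0⟩ x hx, min_le_left m' (kap / 4)]
    · intro t ht x hx hx'
      have hx : Z0 + 1 ≤ x + c * t := hx
      have hx' : x + c * t ≤ Z0 + 1 + c * h := not_lt.1 hx'
      rcases le_total t T with htT | htT
      · linarith [hlow t ⟨ht, htT⟩ x hx, min_le_left m' (kap / 4)]
      · have h1 := (abs_le.1 (hweight t ht x)).1
        have h2 : A * Real.exp (-(γ * t)) * Real.exp (lam * (x + c * t)) ≤
            A * Real.exp (-(γ * t)) * Real.exp (lam * (Z0 + 1 + c * h)) := by gcongr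
        have h3 := (hZ0 (x + c * t) (by linarith)).1
        simp only [hv] at h1
        linarith [hT t htT, min_le_right m' (kap / 4)]
    · intro t ht x hx hpast
      have hx : Z0 + 1 + c * h < x + c * t := hx
      have hpast := hpast (show Z0 + 1 ≤ x + c * (t - h) by linarith)
      refine ⟨_, ?_, (hu.hasHeatOp ht x).sub (hasHeatOp_const _ t x)⟩
      have h1 := hH.self_le_map hmin
        ((min_le_right m' (kap / 4)).trans (by linarith [hH.kap_pos]))
      have h2 := hmono.monotone (sub_nonneg.1 hpast)
      linarith
  -- contraction near `kap` and decay ahead of the front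
  obtain ⟨ε, hε, k, hk0, hk1, hcontr⟩ := hH.contraction hmono hm (M := max M0 kap)
  obtain ⟨Z2, hZ2⟩ := Filter.eventually_atTop.1
    ((hφtop.eventually (Metric.closedBall_mem_nhds kap hε)).and
      (eventually_ge_atTop (max Z1 0)))
  obtain ⟨γ₁, hγ₁, hγ₁le⟩ := exists_pos_rate (h := h) hk1
  set γ₂ : ℝ := min γ γ₁ with hγ₂
  have hγ₂0 : 0 < γ₂ := lt_min hγ hγ₁
  have hγ₂γ : γ₂ ≤ γ := min_le_left _ _
  have hγ₂γ₁ : γ₂ ≤ γ₁ := min_le_right _ _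
  have hZ20 : 0 ≤ Z2 := (le_max_right Z1 0).trans (hZ2 Z2 le_rfl).2
  set W : ℝ := Real.exp (lam * (Z2 + c * h)) with hW
  set B : ℝ := A * Real.exp (γ * h) * W with hBdef
  have hW1 : 1 ≤ W := Real.one_le_exp (by positivity)
  have hE1 : 1 ≤ Real.exp (γ * h) := Real.one_le_exp (by positivity)
  have hrate : ∀ t, -h ≤ t → Real.exp (-(γ * t)) ≤ Real.exp (γ * h) * Real.exp (-(γ₂ * t)) := by
    intro t ht
    rw [← Real.exp_add]
    refine Real.exp_le_exp.2 ?_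
    nlinarith [mul_nonneg (sub_nonneg.2 hγ₂γ) (by linarith : 0 ≤ t + h)]
  have hleft : ∀ t, -h ≤ t → ∀ x, x + c * t ≤ Z2 + c * h →
      |v t x| ≤ B * Real.exp (-(γ₂ * t)) := by
    intro t ht x hx
    calc |v t x| ≤ A * Real.exp (-(γ * t)) * Real.exp (lam * (x + c * t)) := hweight t ht x
      _ ≤ A * (Real.exp (γ * h) * Real.exp (-(γ₂ * t))) * W := by
          gcongr
          · exact hrate t ht
          · exact Real.exp_le_exp.2 (by gcongr)
      _ = B * Real.exp (-(γ₂ * t)) := by rw [hBdef]; ring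
  have hright : ∀ t, -h ≤ t → ∀ x, Z2 ≤ x + c * t → |v t x| ≤ B * Real.exp (-(γ₂ * t)) := by
    have hform : ∀ t x : ℝ, B * Real.exp (-(γ₂ * t)) = B * Real.exp (-γ₂ * t + 0 * x) :=
      fun t x => by ring_nf
    intro t ht x hx
    rw [hform t x]
    refine abs_le_exp_of_delayed_hasHeatOp (r := r) (k := k)
      (isOpen_movingHalfPlane c (Z2 + c * h)) (isClosed_movingHalfPlane c Z2)
      (fun p (hp : Z2 + c * h < p.2 + c * p.1) => show Z2 ≤ p.2 + c * p.1 by nlinarith)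
      hh hk0 (by positivity) ?_ hvcont hvbdd ?_ ?_ ?_ (fun t ht x _ => hvop t ht x) ?_
      (fun t _ x _ => hsign t x) t ht x hx
    · have : k * Real.exp (γ₂ * h) ≤ k * Real.exp (γ₁ * h) := by gcongr
      rw [show -(-γ₂ * h) = γ₂ * h by ring]
      linarith
    · intro t ht x _
      rw [← hform]
      have h1 : eta lam (x + c * t) ≤ 1 := min_le_right _ _
      have h2 : 1 ≤ Real.exp (-(γ₂ * t)) := Real.one_le_exp (by nlinarith [ht.2])
      calc |v t x| ≤ A * eta lam (x + c * t) := hv0 t ht x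
        _ ≤ A * 1 * 1 * 1 := by
            simp only [mul_one]; exact mul_le_of_le_one_right hA h1
        _ ≤ B * Real.exp (-(γ₂ * t)) := by rw [hBdef]; gcongr
    · intro t ht x _ hx'
      rw [← hform]
      exact hleft t ht x (not_lt.1 hx')
    · intro t _ x hx
      have hx : Z2 + c * h < x + c * t := hx
      exact show Z2 ≤ x + c * (t - h) by linarith
    · intro t ht x hx
      have hx : Z2 + c * h < x + c * t := hx
      have hz := hZ2 (x + c * (t - h)) (by linarith)
      have hth : -h ≤ t - h := by linarith
      refine hcontr _ ⟨hZ1 _ hth x ((le_max_left Z1 0).trans hz.2), huM _ hth x⟩ _ ?_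
      simpa [Real.dist_eq] using hz.1
  refine ⟨B + 1, by positivity, γ₂, hγ₂0, fun t ht x => ?_⟩
  have hth : -h ≤ t := by linarith
  have hB : B * Real.exp (-(γ₂ * t)) ≤ (B + 1) * Real.exp (-(γ₂ * t)) := by gcongr; linarith
  rcases le_total (x + c * t) 0 with hz | hz
  · have hη : eta lam (x + c * t) = Real.exp (lam * (x + c * t)) :=
      min_eq_left (Real.exp_le_one_iff.2 (mul_nonpos_of_nonneg_of_nonpos hlam0.le hz))
    rw [hη]
    refine (hweight t hth x).trans (mul_le_mul_of_nonneg_right ?_ (Real.exp_pos _).le)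
    refine le_trans ?_ hB
    calc A * Real.exp (-(γ * t))
        ≤ A * (Real.exp (γ * h) * Real.exp (-(γ₂ * t))) * 1 := by
          rw [mul_one]; gcongr; exact hrate t hth
      _ ≤ A * (Real.exp (γ * h) * Real.exp (-(γ₂ * t))) * W := by gcongr
      _ = B * Real.exp (-(γ₂ * t)) := by rw [hBdef]; ring
  · have hη : eta lam (x + c * t) = 1 := min_eq_right (Real.one_le_exp (by positivity))
    rw [hη, mul_one]
    refine le_trans ?_ hB
    rcases le_total (x + c * t) Z2 with hz2 | hz2
    · exact hleft t hth x (by nlinarith)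
    · exact hright t hth x hz2
end
end

section
/- Assume (UM): g satisfies (H), L_g = g'(0), and g is bounded. Let w₀ satisfy (IC1), let c > c_# (χ₀(·;c) has two distinct positive real zeros λ₁(c) < λ₂(c)), fix λ ∈ (λ₁(c), λ₂(c)), and let φ be a semi-wavefront with speed c. Suppose in addition that g is differentiable on [κ−ρ, κ+ρ] with |g'(u)| < 1 there, for some ρ > 0, and that for some b ≥ 0: (i) κ − ρ/4 ≤ w₀(s,x) ≤ κ + ρ/4 and κ − ρ/4 ≤ φ(x+cs) ≤ κ + ρ/4 for all x ≥ b − ch, s ∈ [−h,0]; (ii) |w₀(s,x) − φ(x+cs)| ≤ 0.5ρ e^{λ(x+cs−b)} for all x ≤ b, s ∈ [−h,0]. Then φ is actually a wavefront (φ(+∞) = κ) and there exists γ > 0 such that every classical solution u of (*) with initial datum w₀ satisfies sup_{x∈ℝ} |u(t,x) − φ(x+ct)| / η_λ(x+ct) ≤ 0.5ρ e^{−γt} for all t ≥ 0. -/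
open Set Filter

noncomputable section

/-- Second derivative test, necessary condition at a local maximum. -/
theorem IsLocalMax.second_deriv_nonpos {f f' : ℝ → ℝ} {s x : ℝ} (hmax : IsLocalMax f x)
    (hf : ∀ᶠ y in nhds x, HasDerivAt f (f' y) y) (hf' : HasDerivAt f' s x) :
    f' x = 0 ∧ s ≤ 0 := by
  have hx : HasDerivAt f (f' x) x := hf.self_of_nhds
  have h0 : f' x = 0 := hmax.hasDerivAt_eq_zero hx
  refine ⟨h0, ?_⟩
  by_contra! hs
  have hderiv : deriv f =ᶠ[nhds x] f' := hf.mono fun y hy => hy.deriv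
  have hdd : deriv (deriv f) x = s := by rw [hderiv.deriv_eq]; exact hf'.deriv
  have hmin : IsLocalMin f x := by
    apply isLocalMin_of_deriv_deriv_pos
    · rw [hdd]; exact hs
    · rw [hx.deriv, h0]
    · exact hx.continuousAt
  have hconst : f =ᶠ[nhds x] fun _ => f x := by
    filter_upwards [hmax, hmin] with y h1 h2 using le_antisymm h1 h2
  have hd0 : deriv f =ᶠ[nhds x] fun _ => (0 : ℝ) := by
    have := hconst.deriv
    simpa using this
  have h00 : deriv (deriv f) x = 0 := by rw [hd0.deriv_eq]; simp
  linarith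

/-- A function whose maximum over the past is attained at `t` has nonnegative derivative there. -/
theorem deriv_nonneg_of_past_max {f : ℝ → ℝ} {p t : ℝ} (hf : HasDerivAt f p t)
    (hmax : ∀ᶠ τ in nhdsWithin t (Iio t), f τ ≤ f t) : 0 ≤ p := by
  have h := hf.hasDerivWithinAt (s := Iio t)
  rw [hasDerivWithinAt_iff_tendsto_slope' (by simp)] at h
  refine ge_of_tendsto h ?_
  filter_upwards [hmax, self_mem_nhdsWithin] with τ h1 h2
  rw [slope_def_field]
  have : τ < t := h2
  exact div_nonneg_of_nonpos (by linarith) (by linarith)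

/-- Maximum principle for `v_t - v_xx + v ≤ 0` on a strip, the differential inequality being
required only for test functions touching `v` from below. -/
theorem strip_max_principle {v : ℝ → ℝ → ℝ} {t0 t1 M : ℝ}
    (hcont : ContinuousOn (fun p : ℝ × ℝ => v p.1 p.2) (Icc t0 t1 ×ˢ univ))
    (hbound : ∀ t ∈ Icc t0 t1, ∀ x, v t x ≤ M)
    (hinit : ∀ x, v t0 x ≤ 0)
    (htouch : ∀ t ∈ Ioc t0 t1, ∀ x, ∃ (V W W' : ℝ → ℝ) (p s : ℝ),
      V t = v t x ∧ W x = v t x ∧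
      (∀ᶠ τ in nhdsWithin t (Iio t), V τ ≤ v τ x) ∧ (∀ᶠ y in nhds x, W y ≤ v t y) ∧
      HasDerivAt V p t ∧ (∀ᶠ y in nhds x, HasDerivAt W (W' y) y) ∧ HasDerivAt W' s x ∧
      p - s + v t x ≤ 0) :
    ∀ t ∈ Icc t0 t1, ∀ x, v t x ≤ 0 := by
  have key : ∀ e > 0, ∀ t ∈ Icc t0 t1, ∀ x,
      v t x - e * (Real.exp (2 * t) * (1 + x ^ 2)) ≤ 0 := by
    intro e he t ht x
    by_contra! hpos
    set F : ℝ × ℝ → ℝ := fun p => v p.1 p.2 - e * (Real.exp (2 * p.1) * (1 + p.2 ^ 2)) with hF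
    have hFc : ContinuousOn F (Icc t0 t1 ×ˢ univ) := by
      apply hcont.sub
      fun_prop
    obtain ⟨R, hR⟩ : ∃ R : ℝ, R = |x| + 1 + |M| / (e * Real.exp (2 * t0)) := ⟨_, rfl⟩
    have hE : 0 < e * Real.exp (2 * t0) := by positivity
    have hq : 0 ≤ |M| / (e * Real.exp (2 * t0)) := by positivity
    have hR1 : 1 ≤ R := by have := abs_nonneg x; linarith
    have hxR : |x| ≤ R := by linarith
    have hRM : |M| ≤ e * Real.exp (2 * t0) * R := by
      have : |M| / (e * Real.exp (2 * t0)) ≤ R := by have := abs_nonneg x; linarith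
      rw [div_le_iff₀ hE] at this
      linarith
    have houtside : ∀ τ ∈ Icc t0 t1, ∀ y, R ≤ |y| → F (τ, y) ≤ 0 := by
      intro τ hτ y hy
      have h1 := hbound τ hτ y
      have h2 : Real.exp (2 * t0) ≤ Real.exp (2 * τ) := Real.exp_le_exp.2 (by linarith [hτ.1])
      have h3 : R ≤ 1 + y ^ 2 := by
        rw [← sq_abs]; nlinarith
      have h4 : e * Real.exp (2 * t0) * R ≤ e * (Real.exp (2 * τ) * (1 + y ^ 2)) := by
        rw [mul_assoc]
        gcongr
      have := le_abs_self M
      simp only [hF]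
      linarith
    have hK : IsCompact (Icc t0 t1 ×ˢ Icc (-R) R) := isCompact_Icc.prod isCompact_Icc
    have hmem : (t, x) ∈ Icc t0 t1 ×ˢ Icc (-R) R := ⟨ht, abs_le.1 hxR⟩
    obtain ⟨⟨T, X⟩, ⟨hT, -⟩, hmaxK⟩ := hK.exists_isMaxOn ⟨_, hmem⟩
      (hFc.mono (prod_mono le_rfl (subset_univ _)))
    have hFpos : 0 < F (T, X) := lt_of_lt_of_le hpos (hmaxK hmem)
    have hglob : ∀ τ ∈ Icc t0 t1, ∀ y, F (τ, y) ≤ F (T, X) := by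
      intro τ hτ y
      by_cases hy : |y| ≤ R
      · exact hmaxK (show (τ, y) ∈ Icc t0 t1 ×ˢ Icc (-R) R from ⟨hτ, abs_le.1 hy⟩)
      · exact (houtside τ hτ y (le_of_not_ge hy)).trans hFpos.le
    have hT0 : t0 < T := by
      rcases hT.1.eq_or_lt with h | h
      · exfalso
        have h1 := hinit X
        have h2 : 0 ≤ e * (Real.exp (2 * T) * (1 + X ^ 2)) := by positivity
        simp only [hF] at hFpos
        have h3 : t0 = T := h
        rw [← h3] at hFpos h2
        linarith
      · exact h
    obtain ⟨V, W, W', p, s, hV, hW, hVle, hWle, hVd, hWd, hWdd, hineq⟩ :=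
      htouch T ⟨hT0, hT.2⟩ X
    have htime : 0 ≤ p - e * (2 * Real.exp (2 * T) * (1 + X ^ 2)) := by
      have hd : HasDerivAt (fun τ => V τ - e * (Real.exp (2 * τ) * (1 + X ^ 2)))
          (p - e * (2 * Real.exp (2 * T) * (1 + X ^ 2))) T := by
        refine hVd.sub (HasDerivAt.const_mul e (HasDerivAt.mul_const ?_ _))
        have := ((hasDerivAt_id T).const_mul 2).exp
        simpa [mul_comm] using this
      refine deriv_nonneg_of_past_max hd ?_
      have hgt : ∀ᶠ τ in nhdsWithin T (Iio T), t0 < τ :=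
        nhdsWithin_le_nhds (lt_mem_nhds hT0)
      filter_upwards [hVle, hgt, self_mem_nhdsWithin] with τ h1 h2 h3
      have h4 : τ < T := h3
      have := hglob τ ⟨h2.le, h4.le.trans hT.2⟩ X
      simp only [hF] at this
      linarith
    have hspace : s - e * (Real.exp (2 * T) * 2) ≤ 0 := by
      have hmax : IsLocalMax (fun y => W y - e * (Real.exp (2 * T) * (1 + y ^ 2))) X := by
        filter_upwards [hWle] with y hy
        have := hglob T hT y
        simp only [hF] at this
        linarith
      refine (hmax.second_deriv_nonpos
        (f' := fun y => W' y - e * (Real.exp (2 * T) * (2 * y))) ?_ ?_).2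
      · filter_upwards [hWd] with y hy
        refine hy.sub (HasDerivAt.const_mul e (HasDerivAt.const_mul _ ?_))
        simpa using (hasDerivAt_pow 2 y).const_add 1
      · refine hWdd.sub (HasDerivAt.const_mul e (HasDerivAt.const_mul _ ?_))
        simpa using (hasDerivAt_id X).const_mul 2
    have hQ : 0 ≤ e * (Real.exp (2 * T) * X ^ 2) := by positivity
    have hQ' : 0 < e * Real.exp (2 * T) := by positivity
    simp only [hF] at hFpos
    linarith
  intro t ht x
  refine le_of_forall_pos_le_add fun δ hδ => ?_
  have hP : 0 < Real.exp (2 * t) * (1 + x ^ 2) := by positivity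
  have := key (δ / (Real.exp (2 * t) * (1 + x ^ 2))) (by positivity) t ht x
  rw [div_mul_cancel₀ _ hP.ne'] at this
  linarith

/-- A bounded solution of `ψ'' - cψ' - ψ + f = 0` on a half-line with `f ≤ m` is, up to an
exponentially small term, at most `m`. -/
theorem le_add_exp_of_profile_eq {ψ ψ' ψ'' f : ℝ → ℝ} {c z0 m C : ℝ} (hc : 0 < c) (hC : 0 ≤ C)
    (hm : 0 ≤ m)
    (h1 : ∀ z, HasDerivAt ψ (ψ' z) z) (h2 : ∀ z, HasDerivAt ψ' (ψ'' z) z)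
    (heq : ∀ z, ψ'' z - c * ψ' z - ψ z + f z = 0)
    (hψ : ∀ z ≥ z0, ψ z ≤ C) (hf : ∀ z ≥ z0, f z ≤ m) :
    ∀ z ≥ z0, ψ z ≤ m + C * Real.exp (-((1 / (1 + c)) * (z - z0))) := by
  intro z hz
  set a : ℝ := 1 / (1 + c) with ha
  have ha1 : a ^ 2 + c * a ≤ 1 := by
    have h3 : a * (1 + c) = 1 := by rw [ha]; field_simp
    have h4 : 0 < a := by positivity
    have h5 : a ≤ 1 := by nlinarith
    nlinarith
  refine le_of_forall_pos_le_add fun δ hδ => ?_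
  set e : ℝ := δ / Real.exp (c * (z - z0)) with he
  have hepos : 0 < e := by positivity
  set V : ℝ → ℝ := fun y => ψ y - m - C * Real.exp (-(a * (y - z0))) - e * Real.exp (c * (y - z0))
    with hV
  have hVd : ∀ y, HasDerivAt V (ψ' y - C * (-a * Real.exp (-(a * (y - z0))))
      - e * (c * Real.exp (c * (y - z0)))) y := by
    intro y
    refine (((h1 y).sub_const m).sub (HasDerivAt.const_mul C ?_)).sub (HasDerivAt.const_mul e ?_)
    · have := ((((hasDerivAt_id y).sub_const z0).const_mul a).neg).exp
      simpa [mul_comm] using this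
    · have := ((((hasDerivAt_id y).sub_const z0).const_mul c)).exp
      simpa [mul_comm] using this
  have hVdd : ∀ y, HasDerivAt (fun y => ψ' y - C * (-a * Real.exp (-(a * (y - z0))))
      - e * (c * Real.exp (c * (y - z0))))
      (ψ'' y - C * (-a * (-a * Real.exp (-(a * (y - z0)))))
        - e * (c * (c * Real.exp (c * (y - z0))))) y := by
    intro y
    refine (((h2 y)).sub (HasDerivAt.const_mul C (HasDerivAt.const_mul _ ?_))).sub
      (HasDerivAt.const_mul e (HasDerivAt.const_mul _ ?_))
    · have := ((((hasDerivAt_id y).sub_const z0).const_mul a).neg).exp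
      simpa [mul_comm] using this
    · have := ((((hasDerivAt_id y).sub_const z0).const_mul c)).exp
      simpa [mul_comm] using this
  suffices hle : V z ≤ 0 by
    have h3 : e * Real.exp (c * (z - z0)) = δ := by rw [he]; field_simp
    simp only [hV] at hle
    linarith
  by_contra! hpos
  have hV0 : V z0 ≤ 0 := by
    have := hψ z0 le_rfl
    simp only [hV, sub_self, mul_zero, neg_zero, Real.exp_zero]
    linarith
  obtain ⟨Z, hZz, hVZ⟩ : ∃ Z, z < Z ∧ V Z ≤ 0 := by
    refine ⟨z + 1 + C / (e * c), ?_, ?_⟩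
    · have : 0 ≤ C / (e * c) := by positivity
      linarith
    · set Z := z + 1 + C / (e * c) with hZ
      have h5 : 0 ≤ C / (e * c) := by positivity
      have h3 := hψ Z (by linarith)
      have h4 : c * (C / (e * c)) ≤ Real.exp (c * (Z - z0)) := by
        have := Real.add_one_le_exp (c * (Z - z0))
        have h6 : c * (C / (e * c)) ≤ c * (Z - z0) := by
          gcongr; linarith
        linarith
      have h7 : e * (c * (C / (e * c))) = C := by field_simp
      have h8 : C ≤ e * Real.exp (c * (Z - z0)) := by rw [← h7]; gcongr
      have h9 : 0 ≤ C * Real.exp (-(a * (Z - z0))) := by positivity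
      simp only [hV]
      linarith
  have hVc : Continuous V := continuous_iff_continuousAt.2 fun y => (hVd y).continuousAt
  obtain ⟨y, hy, hymax⟩ := (isCompact_Icc (a := z0) (b := Z)).exists_isMaxOn
    ⟨z, hz, hZz.le⟩ hVc.continuousOn
  have hypos : 0 < V y := hpos.trans_le (hymax (show z ∈ Icc z0 Z from ⟨hz, hZz.le⟩))
  have hy1 : z0 < y := lt_of_le_of_ne hy.1 fun h => by rw [← h] at hypos; linarith
  have hy2 : y < Z := lt_of_le_of_ne hy.2 fun h => by rw [h] at hypos; linarith
  have hloc : IsLocalMax V y := hymax.isLocalMax (Icc_mem_nhds hy1 hy2)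
  obtain ⟨h3, h4⟩ := hloc.second_deriv_nonpos (Eventually.of_forall hVd) (hVdd y)
  have h5 := heq y
  have h6 := hf y hy1.le
  have h7 : 0 < e * Real.exp (c * (y - z0)) := by positivity
  have h8 : 0 ≤ C * Real.exp (-(a * (y - z0))) := by positivity
  have h9 : 0 ≤ (1 - (a ^ 2 + c * a)) * (C * Real.exp (-(a * (y - z0)))) :=
    mul_nonneg (by linarith) h8
  simp only [hV] at hypos
  nlinarith
section Contraction

variable {g : ℝ → ℝ} {kap ρ : ℝ}

theorem abs_sub_lt_of_abs_deriv_lt_one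
    (hg' : ∀ v ∈ Icc (kap - ρ) (kap + ρ), DifferentiableAt ℝ g v ∧ |deriv g v| < 1)
    {u v : ℝ} (hu : u ∈ Icc (kap - ρ) (kap + ρ)) (hv : v ∈ Icc (kap - ρ) (kap + ρ))
    (huv : u ≠ v) : |g u - g v| < |u - v| := by
  wlog hlt : v < u generalizing u v
  · rw [abs_sub_comm (g u), abs_sub_comm u]
    exact this hv hu huv.symm (lt_of_le_of_ne (not_lt.1 hlt) huv)
  have hsub : Icc v u ⊆ Icc (kap - ρ) (kap + ρ) := Icc_subset_Icc hv.1 hu.2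
  obtain ⟨w, hw, hwe⟩ := exists_deriv_eq_slope g hlt
    (fun y hy => (hg' y (hsub hy)).1.continuousAt.continuousWithinAt)
    (fun y hy => (hg' y (hsub (Ioo_subset_Icc_self hy))).1.differentiableWithinAt)
  have h1 := (hg' w (hsub (Ioo_subset_Icc_self hw))).2
  have hpos : 0 < |u - v| := abs_pos.2 (sub_ne_zero.2 huv)
  rwa [hwe, abs_div, div_lt_one hpos] at h1

/-- Away from the diagonal the contraction is uniform. -/
theorem exists_uniform_contraction_off_diagonal
    (hg' : ∀ v ∈ Icc (kap - ρ) (kap + ρ), DifferentiableAt ℝ g v ∧ |deriv g v| < 1)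
    {d0 : ℝ} (hd0 : 0 < d0) :
    ∃ q, 0 < q ∧ q < 1 ∧ ∀ u ∈ Icc (kap - ρ) (kap + ρ), ∀ v ∈ Icc (kap - ρ) (kap + ρ),
      d0 ≤ |u - v| → |g u - g v| ≤ q * |u - v| := by
  set K : Set (ℝ × ℝ) := (Icc (kap - ρ) (kap + ρ) ×ˢ Icc (kap - ρ) (kap + ρ)) ∩
    {p | d0 ≤ |p.1 - p.2|} with hK
  have hKc : IsCompact K := (isCompact_Icc.prod isCompact_Icc).inter_right
    (isClosed_le continuous_const (by fun_prop))
  rcases K.eq_empty_or_nonempty with hemp | hne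
  · refine ⟨1 / 2, by norm_num, by norm_num, fun u hu v hv huv => ?_⟩
    have : (u, v) ∈ K := ⟨⟨hu, hv⟩, huv⟩
    simp [hemp] at this
  have hgc : ContinuousOn g (Icc (kap - ρ) (kap + ρ)) :=
    fun y hy => (hg' y hy).1.continuousAt.continuousWithinAt
  have hcont : ContinuousOn (fun p : ℝ × ℝ => |g p.1 - g p.2| / |p.1 - p.2|) K := by
    apply ContinuousOn.div
    · apply ContinuousOn.abs
      exact (hgc.comp continuousOn_fst fun p hp => hp.1.1).sub
        (hgc.comp continuousOn_snd fun p hp => hp.1.2)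
    · fun_prop
    · intro p hp
      exact (hd0.trans_le hp.2).ne'
  obtain ⟨p, hp, hmax⟩ := hKc.exists_isMaxOn hne hcont
  have hppos : 0 < |p.1 - p.2| := hd0.trans_le hp.2
  have hp1 : |g p.1 - g p.2| / |p.1 - p.2| < 1 := by
    rw [div_lt_one hppos]
    exact abs_sub_lt_of_abs_deriv_lt_one hg' hp.1.1 hp.1.2 (sub_ne_zero.1 (abs_pos.1 hppos))
  refine ⟨max (1 / 2) (|g p.1 - g p.2| / |p.1 - p.2|), by positivity,
    max_lt (by norm_num) hp1, fun u hu v hv huv => ?_⟩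
  have h1 : |g u - g v| / |u - v| ≤ |g p.1 - g p.2| / |p.1 - p.2| :=
    hmax (show (u, v) ∈ K from ⟨⟨hu, hv⟩, huv⟩)
  rw [← div_le_iff₀ (hd0.trans_le huv)]
  exact h1.trans (le_max_right _ _)

theorem exists_modulus_contraction
    (hg' : ∀ v ∈ Icc (kap - ρ) (kap + ρ), DifferentiableAt ℝ g v ∧ |deriv g v| < 1)
    {d0 : ℝ} (hd0 : 0 < d0) :
    ∃ q, 0 < q ∧ q < 1 ∧ ∀ d ≥ d0, ∀ u ∈ Icc (kap - ρ) (kap + ρ),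
      ∀ v ∈ Icc (kap - ρ) (kap + ρ), |u - v| ≤ d → |g u - g v| ≤ q * d := by
  obtain ⟨q, hq0, hq1, hq⟩ := exists_uniform_contraction_off_diagonal hg' (half_pos hd0)
  refine ⟨max q (1 / 2), lt_max_of_lt_left hq0, max_lt hq1 (by norm_num), fun d hd u hu v hv huv => ?_⟩
  by_cases h : d0 / 2 ≤ |u - v|
  · calc |g u - g v| ≤ q * |u - v| := hq u hu v hv h
      _ ≤ max q (1 / 2) * d := by
        gcongr
        exact le_max_left _ _
  · have h1 : |g u - g v| ≤ |u - v| := by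
      rcases eq_or_ne u v with rfl | hne
      · simp
      · exact (abs_sub_lt_of_abs_deriv_lt_one hg' hu hv hne).le
    calc |g u - g v| ≤ 1 / 2 * d := by linarith
      _ ≤ max q (1 / 2) * d :=
        mul_le_mul_of_nonneg_right (le_max_right _ _) (by linarith)

theorem exists_contraction_near_fixed_point (hρ : 0 < ρ)
    (hsmooth : ContDiffAt ℝ 1 g kap)
    (hg' : ∀ v ∈ Icc (kap - ρ) (kap + ρ), DifferentiableAt ℝ g v ∧ |deriv g v| < 1) :
    ∃ r > 0, ∃ q, 0 < q ∧ q < 1 ∧ ∀ u ∈ Icc (kap - ρ) (kap + ρ),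
      ∀ v ∈ Icc (kap - ρ) (kap + ρ), |u - kap| ≤ r → |g u - g v| ≤ q * |u - v| := by
  have hstrict : HasStrictDerivAt g (deriv g kap) kap := hsmooth.hasStrictDerivAt (by simp)
  have hk : |deriv g kap| < 1 := (hg' kap ⟨by linarith, by linarith⟩).2
  obtain ⟨q1, hq1, hq1'⟩ := exists_between hk
  have hO := hstrict.hasStrictFDerivAt.isLittleO.def (sub_pos.2 hq1)
  rw [Metric.eventually_nhds_iff] at hO
  obtain ⟨R, hR, hball⟩ := hO
  have hnear : ∀ u v, |u - kap| < R → |v - kap| < R → |g u - g v| ≤ q1 * |u - v| := by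
    intro u v hu hv
    have h1 := hball (y := (u, v)) (by
      rw [Prod.dist_eq, max_lt_iff]
      exact ⟨hu, hv⟩)
    simp only [Real.norm_eq_abs, ContinuousLinearMap.toSpanSingleton_apply, smul_eq_mul] at h1
    have h2 : |g u - g v| ≤ |g u - g v - (u - v) * deriv g kap| + |(u - v) * deriv g kap| := by
      have := abs_add_le (g u - g v - (u - v) * deriv g kap) ((u - v) * deriv g kap)
      simpa using this
    rw [abs_mul] at h2
    nlinarith
  obtain ⟨q, hq0, hq, hqq⟩ := exists_uniform_contraction_off_diagonal hg' (half_pos hR)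
  refine ⟨R / 3, by positivity, max q q1, by positivity, max_lt hq hq1', fun u hu v hv h => ?_⟩
  by_cases hd : R / 2 ≤ |u - v|
  · refine (hqq u hu v hv hd).trans ?_
    gcongr
    exact le_max_left _ _
  · refine (hnear u v (by linarith) ?_).trans ?_
    · have := abs_sub_le v u kap
      rw [abs_sub_comm v u] at this
      linarith
    · gcongr
      exact le_max_right _ _

end Contraction

theorem chi_neg_of_between {G c h l1 l2 l : ℝ} (hG : 0 < G)
    (h1 : l1 ^ 2 - c * l1 - 1 + G * Real.exp (-(l1 * c * h)) = 0)
    (h2 : l2 ^ 2 - c * l2 - 1 + G * Real.exp (-(l2 * c * h)) = 0)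
    (hl : l ∈ Ioo l1 l2) :
    l ^ 2 - c * l - 1 + G * Real.exp (-(l * c * h)) < 0 := by
  have hd : 0 < l2 - l1 := by linarith [hl.1, hl.2]
  set a := (l2 - l) / (l2 - l1) with ha
  set b := (l - l1) / (l2 - l1) with hb
  have ha0 : 0 < a := div_pos (by linarith [hl.2]) hd
  have hb0 : 0 < b := div_pos (by linarith [hl.1]) hd
  have hab : a + b = 1 := by rw [ha, hb]; field_simp; ring
  have hcomb : l = a * l1 + b * l2 := by rw [ha, hb]; field_simp; ring
  have hexp := convexOn_exp.2 (mem_univ (-(l1 * c * h))) (mem_univ (-(l2 * c * h)))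
    ha0.le hb0.le hab
  simp only [smul_eq_mul] at hexp
  have harg : -(l * c * h) = a * -(l1 * c * h) + b * -(l2 * c * h) := by rw [hcomb]; ring
  rw [← harg] at hexp
  have hsq : l ^ 2 < a * l1 ^ 2 + b * l2 ^ 2 := by
    have h3 : a * l1 ^ 2 + b * l2 ^ 2 - l ^ 2 = a * b * (l2 - l1) ^ 2 := by
      have hb' : b = 1 - a := by linarith
      rw [hcomb, hb']; ring
    have : 0 < a * b * (l2 - l1) ^ 2 := by positivity
    linarith
  have h3 : G * Real.exp (-(l * c * h)) ≤
      a * (G * Real.exp (-(l1 * c * h))) + b * (G * Real.exp (-(l2 * c * h))) := by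
    have := mul_le_mul_of_nonneg_left hexp hG.le
    linarith
  have h4 : a * (l1 ^ 2 - c * l1 - 1 + G * Real.exp (-(l1 * c * h)))
      + b * (l2 ^ 2 - c * l2 - 1 + G * Real.exp (-(l2 * c * h))) = 0 := by rw [h1, h2]; ring
  have h5 : c * l = a * (c * l1) + b * (c * l2) := by rw [hcomb]; ring
  nlinarith
/-- The profile converges to the fixed point once it stays in a neighbourhood where `g` is a
(possibly non-uniform) contraction. -/
theorem profile_tendsto_of_contraction {g φ φ' φ'' : ℝ → ℝ} {c h kap ρ : ℝ} (hc : 0 < c)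
    (hρ : 0 < ρ) (hgk : g kap = kap)
    (hg' : ∀ v ∈ Icc (kap - ρ) (kap + ρ), DifferentiableAt ℝ g v ∧ |deriv g v| < 1)
    (h1 : ∀ z, HasDerivAt φ (φ' z) z) (h2 : ∀ z, HasDerivAt φ' (φ'' z) z)
    (heq : ∀ z, φ'' z - c * φ' z - φ z + g (φ (z - c * h)) = 0)
    (hnear : ∀ᶠ z in atTop, |φ z - kap| ≤ ρ) : Tendsto φ atTop (nhds kap) := by
  have hstep : ∀ q d : ℝ, 0 < q → q < 1 → 0 < d →
      (∀ v ∈ Icc (kap - ρ) (kap + ρ), |v - kap| ≤ d → |g v - kap| ≤ q * d) → d ≤ ρ →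
      (∀ᶠ z in atTop, |φ z - kap| ≤ d) → ∀ᶠ z in atTop, |φ z - kap| ≤ (1 + q) / 2 * d := by
    intro q d hq0 hq1 hd0 hq hdρ hev
    obtain ⟨z1, hz1⟩ := eventually_atTop.1 hev
    set z0 := max z1 (z1 + c * h) with hz0
    have hf : ∀ z ≥ z0, |g (φ (z - c * h)) - kap| ≤ q * d := by
      intro z hz
      have h3 := hz1 (z - c * h) (by have := le_max_right z1 (z1 + c * h); linarith)
      have h4 := abs_le.1 (h3.trans hdρ)
      exact hq _ ⟨by linarith, by linarith⟩ h3
    have hup := le_add_exp_of_profile_eq (ψ := fun z => φ z - kap) (ψ' := φ') (ψ'' := φ'')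
      (f := fun z => g (φ (z - c * h)) - kap) (z0 := z0) (m := q * d) (C := d) hc hd0.le
      (by positivity) (fun z => (h1 z).sub_const kap) h2 (fun z => by have := heq z; linarith)
      (fun z hz => (abs_le.1 (hz1 z ((le_max_left _ _).trans hz))).2)
      (fun z hz => (abs_le.1 (hf z hz)).2)
    have hdown := le_add_exp_of_profile_eq (ψ := fun z => -(φ z - kap)) (ψ' := fun z => -φ' z)
      (ψ'' := fun z => -φ'' z)
      (f := fun z => -(g (φ (z - c * h)) - kap)) (z0 := z0) (m := q * d) (C := d) hc hd0.le
      (by positivity) (fun z => ((h1 z).sub_const kap).neg) (fun z => (h2 z).neg)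
      (fun z => by have := heq z; linarith)
      (fun z hz => by
        have := (abs_le.1 (hz1 z ((le_max_left _ _).trans hz))).1
        linarith)
      (fun z hz => by
        have := (abs_le.1 (hf z hz)).1
        linarith)
    have hlim : Tendsto (fun z => d * Real.exp (-((1 / (1 + c)) * (z - z0)))) atTop
        (nhds (d * 0)) := by
      refine Tendsto.const_mul d (Real.tendsto_exp_atBot.comp ?_)
      refine tendsto_neg_atTop_atBot.comp ?_
      exact (tendsto_atTop_add_const_right _ (-z0) tendsto_id).const_mul_atTop (by positivity)
    have hsmall : ∀ᶠ z in atTop, d * Real.exp (-((1 / (1 + c)) * (z - z0))) < (1 - q) / 2 * d := by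
      refine hlim.eventually_lt_const ?_
      rw [mul_zero]
      have : 0 < 1 - q := by linarith
      positivity
    filter_upwards [hsmall, eventually_ge_atTop z0] with z h3 h4
    have h5 := hup z h4
    have h6 := hdown z h4
    rw [abs_le]
    constructor <;> linarith
  have hmain : ∀ d0 > 0, d0 ≤ ρ → ∀ᶠ z in atTop, |φ z - kap| ≤ d0 := by
    intro d0 hd0 hd0ρ
    obtain ⟨q, hq0, hq1, hq⟩ := exists_modulus_contraction hg' hd0
    have hiter : ∀ n : ℕ, ∀ᶠ z in atTop, |φ z - kap| ≤ max (((1 + q) / 2) ^ n * ρ) d0 := by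
      intro n
      induction n with
      | zero => simpa using hnear.mono fun z hz => Or.inl hz
      | succ n ih =>
        have hpow : ((1 + q) / 2) ^ n ≤ 1 := pow_le_one₀ (by linarith) (by linarith)
        have hdle : max (((1 + q) / 2) ^ n * ρ) d0 ≤ ρ :=
          max_le (mul_le_of_le_one_left hρ.le hpow) hd0ρ
        have hdge := le_max_right (((1 + q) / 2) ^ n * ρ) d0
        have hs := hstep q _ hq0 hq1 (lt_of_lt_of_le hd0 hdge) (fun v hv hvd => by
          have := hq _ hdge v hv kap ⟨by linarith, by linarith⟩ hvd
          rwa [hgk] at this) hdle ih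
        refine hs.mono fun z hz => hz.trans ?_
        rw [mul_max_of_nonneg _ _ (by linarith)]
        refine max_le_max (by rw [pow_succ]; linarith) ?_
        exact mul_le_of_le_one_left hd0.le (by linarith)
    have hlim : Tendsto (fun n : ℕ => ((1 + q) / 2) ^ n * ρ) atTop (nhds (0 * ρ)) :=
      (tendsto_pow_atTop_nhds_zero_of_lt_one (by linarith) (by linarith)).mul_const ρ
    rw [zero_mul] at hlim
    obtain ⟨n, hn⟩ := (hlim.eventually_lt_const hd0).exists
    exact (hiter n).mono fun z hz => hz.trans (max_le hn.le le_rfl)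
  rw [Metric.tendsto_nhds]
  intro e he
  refine (hmain (min (e / 2) ρ) (lt_min (half_pos he) hρ) (min_le_right _ _)).mono fun z hz => ?_
  rw [Real.dist_eq]
  have := hz.trans (min_le_left _ _)
  linarith

/-- The weight `e^{λ(z-b)}` for `z ≤ b`, continued beyond `b` by a function increasing
from `1` to `1 + e`. -/
def barrierWeight (lam b e z : ℝ) : ℝ :=
  if z ≤ b then Real.exp (lam * (z - b)) else 1 + e - e * Real.exp (-(lam * (z - b)))

section BarrierWeight

variable {lam b e z : ℝ}

theorem barrierWeight_of_le (hz : z ≤ b) : barrierWeight lam b e z = Real.exp (lam * (z - b)) :=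
  if_pos hz

theorem barrierWeight_of_lt (hz : b < z) :
    barrierWeight lam b e z = 1 + e - e * Real.exp (-(lam * (z - b))) :=
  if_neg hz.not_ge

theorem continuous_barrierWeight (lam b e : ℝ) : Continuous (barrierWeight lam b e) := by
  refine Continuous.if_le (by fun_prop) (by fun_prop) continuous_id continuous_const ?_
  intro z hz
  simp [hz]

theorem barrierWeight_le_exp (hlam : 0 < lam) (he0 : 0 ≤ e) (he1 : e ≤ 1) (z : ℝ) :
    barrierWeight lam b e z ≤ Real.exp (lam * (z - b)) := by
  rcases le_or_gt z b with hz | hz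
  · exact (barrierWeight_of_le hz).le
  · rw [barrierWeight_of_lt hz]
    have h1 : 0 ≤ lam * (z - b) := mul_nonneg hlam.le (by linarith)
    have h2 := Real.add_one_le_exp (lam * (z - b))
    have h3 := Real.add_one_le_exp (-(lam * (z - b)))
    nlinarith

theorem exp_le_one_of_le (hlam : 0 < lam) (hz : z ≤ b) : Real.exp (lam * (z - b)) ≤ 1 :=
  Real.exp_le_one_iff.2 (mul_nonpos_of_nonneg_of_nonpos hlam.le (by linarith))

theorem exp_neg_le_one_of_le (hlam : 0 < lam) (hz : b ≤ z) : Real.exp (-(lam * (z - b))) ≤ 1 :=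
  Real.exp_le_one_iff.2 (neg_nonpos.2 (mul_nonneg hlam.le (by linarith)))

theorem barrierWeight_mono (hlam : 0 < lam) (he0 : 0 ≤ e) : Monotone (barrierWeight lam b e) := by
  intro y z hyz
  rcases le_or_gt z b with hz | hz
  · rw [barrierWeight_of_le hz, barrierWeight_of_le (hyz.trans hz)]
    gcongr
  · rw [barrierWeight_of_lt hz]
    rcases le_or_gt y b with hy | hy
    · rw [barrierWeight_of_le hy]
      have h1 := exp_le_one_of_le hlam hy
      have h2 := exp_neg_le_one_of_le hlam hz.le
      nlinarith
    · rw [barrierWeight_of_lt hy]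
      gcongr

theorem barrierWeight_pos (hlam : 0 < lam) (he0 : 0 ≤ e) (z : ℝ) :
    0 < barrierWeight lam b e z := by
  rcases le_or_gt z b with hz | hz
  · rw [barrierWeight_of_le hz]; positivity
  · rw [barrierWeight_of_lt hz]
    have h2 := exp_neg_le_one_of_le hlam hz.le
    nlinarith

theorem barrierWeight_le (hlam : 0 < lam) (he0 : 0 ≤ e) (z : ℝ) :
    barrierWeight lam b e z ≤ 1 + e := by
  rcases le_or_gt z b with hz | hz
  · rw [barrierWeight_of_le hz]
    linarith [exp_le_one_of_le hlam hz]
  · rw [barrierWeight_of_lt hz]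
    have : 0 ≤ e * Real.exp (-(lam * (z - b))) := by positivity
    linarith

theorem barrierWeight_zero_le (hlam : 0 < lam) (he0 : 0 ≤ e) (z : ℝ) :
    barrierWeight lam b 0 z ≤ barrierWeight lam b e z := by
  rcases le_or_gt z b with hz | hz
  · rw [barrierWeight_of_le hz, barrierWeight_of_le hz]
  · rw [barrierWeight_of_lt hz, barrierWeight_of_lt hz]
    have h2 := exp_neg_le_one_of_le hlam hz.le
    nlinarith

theorem barrierWeight_zero_le_eta (hlam : 0 < lam) (hb : 0 ≤ b) (z : ℝ) :
    barrierWeight lam b 0 z ≤ eta lam z := by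
  refine le_min ?_ (by simpa using barrierWeight_le hlam le_rfl z)
  refine (barrierWeight_le_exp hlam le_rfl zero_le_one z).trans (Real.exp_le_exp.2 ?_)
  gcongr
  linarith

theorem barrierWeight_le_mul_zero (hlam : 0 < lam) (he0 : 0 ≤ e) (z : ℝ) :
    barrierWeight lam b e z ≤ (1 + e) * barrierWeight lam b 0 z := by
  rcases le_or_gt z b with hz | hz
  · rw [barrierWeight_of_le hz, barrierWeight_of_le hz]
    have := Real.exp_pos (lam * (z - b))
    nlinarith
  · rw [barrierWeight_of_lt (e := 0) hz]
    simpa using barrierWeight_le hlam he0 z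

end BarrierWeight

/-- `D` is a bounded solution of `D_t = D_xx - D + S` on the strip `(t0, t1] × ℝ`. -/
structure StripSolution (D S : ℝ → ℝ → ℝ) (t0 t1 : ℝ) : Prop where
  cont : ContinuousOn (fun p : ℝ × ℝ => D p.1 p.2) (Icc t0 t1 ×ˢ univ)
  bounded : ∃ M, ∀ t ∈ Icc t0 t1, ∀ x, |D t x| ≤ M
  pde : ∀ t ∈ Ioc t0 t1, ∀ x, ∃ (Dx : ℝ → ℝ) (p s : ℝ), HasDerivAt (fun τ => D τ x) p t ∧
    (∀ y, HasDerivAt (D t) (Dx y) y) ∧ HasDerivAt Dx s x ∧ p - s + D t x = S t x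

theorem StripSolution.neg {D S : ℝ → ℝ → ℝ} {t0 t1 : ℝ} (H : StripSolution D S t0 t1) :
    StripSolution (fun t x => -D t x) (fun t x => -S t x) t0 t1 where
  cont := H.cont.neg
  bounded := by simpa using H.bounded
  pde := by
    intro t ht x
    obtain ⟨Dx, p, s, h1, h2, h3, h4⟩ := H.pde t ht x
    exact ⟨fun y => -Dx y, -p, -s, h1.neg, fun y => (h2 y).neg, h3.neg, by linarith⟩

theorem StripSolution.le_barrier {D S : ℝ → ℝ → ℝ} {t0 t1 c lam b e γ A : ℝ}
    (H : StripSolution D S t0 t1) (hlam : 0 < lam) (he0 : 0 ≤ e) (he1 : e ≤ 1)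
    (hA : 0 ≤ A)
    (hinit : ∀ x, D t0 x ≤ A * Real.exp (-(γ * t0)) * barrierWeight lam b e (x + c * t0))
    (hleft : ∀ t ∈ Ioc t0 t1, ∀ x, x + c * t ≤ b → S t x ≤
      A * Real.exp (-(γ * t)) * (Real.exp (lam * (x + c * t - b)) *
        (1 + c * lam - lam ^ 2 - γ)))
    (hright : ∀ t ∈ Ioc t0 t1, ∀ x, b < x + c * t → S t x ≤
      A * Real.exp (-(γ * t)) *
        ((1 - γ) * (1 + e - e * Real.exp (-(lam * (x + c * t - b))))
          + e * lam * (lam + c) * Real.exp (-(lam * (x + c * t - b))))) :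
    ∀ t ∈ Icc t0 t1, ∀ x,
      D t x ≤ A * Real.exp (-(γ * t)) * barrierWeight lam b e (x + c * t) := by
  have hB0 : ∀ t x, 0 ≤ A * Real.exp (-(γ * t)) * barrierWeight lam b e (x + c * t) :=
    fun t x => mul_nonneg (by positivity) (barrierWeight_pos hlam he0 _).le
  obtain ⟨M, hM⟩ := H.bounded
  suffices hmain : ∀ t ∈ Icc t0 t1, ∀ x,
      D t x - A * Real.exp (-(γ * t)) * barrierWeight lam b e (x + c * t) ≤ 0 from
    fun t ht x => sub_nonpos.1 (hmain t ht x)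
  refine strip_max_principle (M := M)
    (v := fun t x => D t x - A * Real.exp (-(γ * t)) * barrierWeight lam b e (x + c * t))
    ?_ ?_ ?_ ?_
  · refine H.cont.sub (Continuous.continuousOn ?_)
    have := continuous_barrierWeight lam b e
    fun_prop
  · intro t ht x
    have h1 := (abs_le.1 (hM t ht x)).2
    have h2 := hB0 t x
    linarith
  · intro x
    exact sub_nonpos.2 (hinit x)
  · intro t ht x
    obtain ⟨Dx, p, s, h1, h2, h3, h4⟩ := H.pde t ht x
    have hEt : HasDerivAt (fun τ => A * Real.exp (-(γ * τ))) (A * (-γ * Real.exp (-(γ * t)))) t := by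
      refine HasDerivAt.const_mul A ?_
      have := ((hasDerivAt_id t).const_mul γ).neg.exp
      simpa [mul_comm] using this
    rcases le_or_gt (x + c * t) b with hz | hz
    · have hle : ∀ τ y, A * Real.exp (-(γ * τ)) * barrierWeight lam b e (y + c * τ) ≤
          A * Real.exp (-(γ * τ)) * Real.exp (lam * (y + c * τ - b)) := fun τ y =>
        mul_le_mul_of_nonneg_left (barrierWeight_le_exp hlam he0 he1 _) (by positivity)
      have hxt : ∀ y, HasDerivAt (fun y => Real.exp (lam * (y + c * t - b)))
          (lam * Real.exp (lam * (y + c * t - b))) y := by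
        intro y
        have := ((((hasDerivAt_id y).add_const (c * t)).sub_const b).const_mul lam).exp
        simpa [mul_comm] using this
      refine ⟨fun τ => D τ x - A * Real.exp (-(γ * τ)) * Real.exp (lam * (x + c * τ - b)),
        fun y => D t y - A * Real.exp (-(γ * t)) * Real.exp (lam * (y + c * t - b)),
        fun y => Dx y - A * Real.exp (-(γ * t)) * (lam * Real.exp (lam * (y + c * t - b))),
        p - (A * (-γ * Real.exp (-(γ * t))) * Real.exp (lam * (x + c * t - b)) +
          A * Real.exp (-(γ * t)) * (lam * c * Real.exp (lam * (x + c * t - b)))),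
        s - A * Real.exp (-(γ * t)) * (lam * (lam * Real.exp (lam * (x + c * t - b)))),
        ?_, ?_, ?_, ?_, ?_, ?_, ?_, ?_⟩
      · simp only [barrierWeight_of_le hz]
      · simp only [barrierWeight_of_le hz]
      · exact Eventually.of_forall fun τ => sub_le_sub_left (hle τ x) _
      · exact Eventually.of_forall fun y => sub_le_sub_left (hle t y) _
      · refine h1.sub (hEt.mul ?_)
        have := (((((hasDerivAt_id t).const_mul c).const_add x).sub_const b).const_mul lam).exp
        simpa [mul_comm] using this
      · exact Eventually.of_forall fun y => (h2 y).sub ((hxt y).const_mul _)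
      · exact h3.sub (HasDerivAt.const_mul _ ((hxt x).const_mul lam))
      · have := hleft t ht x hz
        simp only [barrierWeight_of_le hz]
        linarith
    · have hxt : ∀ y, HasDerivAt (fun y => Real.exp (-(lam * (y + c * t - b))))
          (-lam * Real.exp (-(lam * (y + c * t - b)))) y := by
        intro y
        have := ((((hasDerivAt_id y).add_const (c * t)).sub_const b).const_mul lam).neg.exp
        simpa [mul_comm] using this
      refine ⟨fun τ => D τ x - A * Real.exp (-(γ * τ)) *
          (1 + e - e * Real.exp (-(lam * (x + c * τ - b)))),
        fun y => D t y - A * Real.exp (-(γ * t)) *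
          (1 + e - e * Real.exp (-(lam * (y + c * t - b)))),
        fun y => Dx y - A * Real.exp (-(γ * t)) *
          (-(e * (-lam * Real.exp (-(lam * (y + c * t - b)))))),
        p - (A * (-γ * Real.exp (-(γ * t))) * (1 + e - e * Real.exp (-(lam * (x + c * t - b)))) +
          A * Real.exp (-(γ * t)) *
            (-(e * (-(lam * c) * Real.exp (-(lam * (x + c * t - b))))))),
        s - A * Real.exp (-(γ * t)) *
          (-(e * (-lam * (-lam * Real.exp (-(lam * (x + c * t - b))))))),
        ?_, ?_, ?_, ?_, ?_, ?_, ?_, ?_⟩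
      · simp only [barrierWeight_of_lt hz]
      · simp only [barrierWeight_of_lt hz]
      · have hev : ∀ᶠ τ in nhds t, b < x + c * τ :=
          (show Continuous fun τ => x + c * τ by fun_prop).continuousAt.eventually_const_lt hz
        filter_upwards [nhdsWithin_le_nhds hev] with τ hτ
        rw [barrierWeight_of_lt hτ]
      · have hev : ∀ᶠ y in nhds x, b < y + c * t :=
          (show Continuous fun y => y + c * t by fun_prop).continuousAt.eventually_const_lt hz
        filter_upwards [hev] with y hy
        rw [barrierWeight_of_lt hy]
      · refine h1.sub (hEt.mul (HasDerivAt.const_sub _ (HasDerivAt.const_mul e ?_)))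
        have := (((((hasDerivAt_id t).const_mul c).const_add x).sub_const b).const_mul lam).neg.exp
        simpa [mul_comm] using this
      · exact Eventually.of_forall fun y =>
          (h2 y).sub (HasDerivAt.const_mul _ (HasDerivAt.const_sub _ ((hxt y).const_mul e)))
      · exact h3.sub (HasDerivAt.const_mul _
          (HasDerivAt.neg (HasDerivAt.const_mul e ((hxt x).const_mul (-lam)))))
      · have := hright t ht x hz
        simp only [barrierWeight_of_lt hz]
        linarith

theorem StripSolution.abs_le_barrier {D S : ℝ → ℝ → ℝ} {t0 t1 c lam b e γ A : ℝ}
    (H : StripSolution D S t0 t1) (hlam : 0 < lam) (he0 : 0 ≤ e) (he1 : e ≤ 1)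
    (hA : 0 ≤ A)
    (hinit : ∀ x, |D t0 x| ≤ A * Real.exp (-(γ * t0)) * barrierWeight lam b e (x + c * t0))
    (hleft : ∀ t ∈ Ioc t0 t1, ∀ x, x + c * t ≤ b → |S t x| ≤
      A * Real.exp (-(γ * t)) * (Real.exp (lam * (x + c * t - b)) *
        (1 + c * lam - lam ^ 2 - γ)))
    (hright : ∀ t ∈ Ioc t0 t1, ∀ x, b < x + c * t → |S t x| ≤
      A * Real.exp (-(γ * t)) *
        ((1 - γ) * (1 + e - e * Real.exp (-(lam * (x + c * t - b))))
          + e * lam * (lam + c) * Real.exp (-(lam * (x + c * t - b))))) :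
    ∀ t ∈ Icc t0 t1, ∀ x,
      |D t x| ≤ A * Real.exp (-(γ * t)) * barrierWeight lam b e (x + c * t) := by
  intro t ht x
  refine abs_le'.2 ⟨?_, ?_⟩
  · exact H.le_barrier hlam he0 he1 hA (fun x => (le_abs_self _).trans (hinit x))
      (fun t ht x hx => (le_abs_self _).trans (hleft t ht x hx))
      (fun t ht x hx => (le_abs_self _).trans (hright t ht x hx)) t ht x
  · exact H.neg.le_barrier hlam he0 he1 hA (fun x => (neg_le_abs _).trans (hinit x))
      (fun t ht x hx => (neg_le_abs _).trans (hleft t ht x hx))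
      (fun t ht x hx => (neg_le_abs _).trans (hright t ht x hx)) t ht x

theorem stripSolution_sub_profile {g φ : ℝ → ℝ} {h c : ℝ} {u : ℝ → ℝ → ℝ} {t0 t1 : ℝ}
    (hh : 0 < h) (hu : SolvesStar g h u) (hφ : IsSemiWavefront g h c φ) (ht0 : 0 ≤ t0) :
    StripSolution (fun t x => u t x - φ (x + c * t))
      (fun t x => g (u (t - h) x) - g (φ (x + c * t - c * h))) t0 t1 := by
  obtain ⟨hφpos, ⟨Mφ, hMφ⟩, hφ2, hφeq, -, -⟩ := hφ
  obtain ⟨hcont, hbd, hpde, -, -, -⟩ := hu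
  have hd1 : ∀ z, HasDerivAt φ (deriv φ z) z := fun z =>
    (hφ2.differentiable (by norm_num) z).hasDerivAt
  have hd2 : ∀ z, HasDerivAt (deriv φ) (deriv (deriv φ) z) z := fun z =>
    ((hφ2.differentiable_deriv_two) z).hasDerivAt
  have hsub : Icc t0 t1 ×ˢ (univ : Set ℝ) ⊆ {p : ℝ × ℝ | -h ≤ p.1} := by
    rintro ⟨t, x⟩ ⟨ht, -⟩
    have := ht.1
    change -h ≤ t
    linarith
  refine ⟨?_, ?_, ?_⟩
  · refine (hcont.mono hsub).sub (Continuous.continuousOn ?_)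
    have := hφ2.continuous
    fun_prop
  · obtain ⟨M, hM⟩ := hbd t1
    refine ⟨M + Mφ, fun t ht x => ?_⟩
    have h1 := hM t ⟨by linarith [ht.1], ht.2⟩ x
    have h2 := hMφ (x + c * t)
    have h3 := hφpos (x + c * t)
    rw [abs_le] at h1 ⊢
    constructor <;> linarith
  · intro t ht x
    have htpos : 0 < t := ht0.trans_lt ht.1
    obtain ⟨h1, -, h3, h4⟩ := hpde t htpos x
    refine ⟨fun y => deriv (fun y => u t y) y - deriv φ (y + c * t),
      deriv (fun τ => u τ x) t - deriv φ (x + c * t) * c,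
      deriv (deriv (fun y => u t y)) x - deriv (deriv φ) (x + c * t), ?_, ?_, ?_, ?_⟩
    · refine h1.hasDerivAt.sub ?_
      have h5 : HasDerivAt (fun τ => x + c * τ) c t := by
        simpa using ((hasDerivAt_id t).const_mul c).const_add x
      exact (hd1 (x + c * t)).comp t h5
    · intro y
      exact ((hpde t htpos y).2.1.hasDerivAt).sub ((hd1 (y + c * t)).comp_add_const y (c * t))
    · exact h3.hasDerivAt.sub ((hd2 (x + c * t)).comp_add_const x (c * t))
    · have := hφeq (x + c * t)
      rw [h4]
      linarith

theorem HypH.lipschitz_all {g : ℝ → ℝ} {kap del0 Lg : ℝ} (hH : HypH g kap del0 Lg)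
    (hLg : Lg = deriv g 0) (u v : ℝ) : |g u - g v| ≤ Lg * |u - v| := by
  have hL : 0 < Lg := by rw [hLg]; linarith [hH.deriv0_gt]
  have h0 : g 0 = 0 := (hH.fixed_points 0 le_rfl).2 (Or.inl rfl)
  have hneg : ∀ x ≤ 0, g x = Lg * x := fun x hx => by rw [hLg]; exact hH.ext_linear x hx
  have hmixed : ∀ a b, 0 ≤ a → b ≤ 0 → |g a - g b| ≤ Lg * |a - b| := by
    intro a b ha hb
    have h1 := hH.lipschitz a 0 ha le_rfl
    rw [h0, sub_zero, sub_zero, abs_of_nonneg ha] at h1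
    have h2 := abs_sub (g a) (g b)
    rw [hneg b hb, abs_mul, abs_of_pos hL, abs_of_nonpos hb] at h2
    rw [abs_of_nonneg (by linarith : 0 ≤ a - b), hneg b hb]
    linarith
  rcases le_total 0 u with hu | hu <;> rcases le_total 0 v with hv | hv
  · exact hH.lipschitz u v hu hv
  · exact hmixed u v hu hv
  · rw [abs_sub_comm, abs_sub_comm u]
    exact hmixed v u hv hu
  · rw [hneg u hu, hneg v hv, ← mul_sub, abs_mul, abs_of_pos hL]

/-- Source estimate behind the front: a Lipschitz reaction term only sees the exponential part
of the weight. -/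
theorem source_le_left {L A γ lam b c h t z d s : ℝ} (hL : 0 ≤ L) (hA : 0 ≤ A)
    (hcoef : γ + L * Real.exp (γ * h) * Real.exp (-(lam * c * h)) ≤ 1 + c * lam - lam ^ 2)
    (hs : s ≤ L * d)
    (hd : d ≤ A * Real.exp (-(γ * (t - h))) * Real.exp (lam * (z - c * h - b))) :
    s ≤ A * Real.exp (-(γ * t)) * (Real.exp (lam * (z - b)) *
        (1 + c * lam - lam ^ 2 - γ)) := by
  have h1 : Real.exp (-(γ * (t - h))) = Real.exp (-(γ * t)) * Real.exp (γ * h) := by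
    rw [← Real.exp_add]; ring_nf
  have h2 : Real.exp (lam * (z - c * h - b)) =
      Real.exp (lam * (z - b)) * Real.exp (-(lam * c * h)) := by
    rw [← Real.exp_add]; ring_nf
  rw [h1, h2] at hd
  calc s ≤ L * d := hs
    _ ≤ L * (A * (Real.exp (-(γ * t)) * Real.exp (γ * h)) *
        (Real.exp (lam * (z - b)) * Real.exp (-(lam * c * h)))) := by gcongr
    _ = A * Real.exp (-(γ * t)) * (Real.exp (lam * (z - b)) *
        (L * Real.exp (γ * h) * Real.exp (-(lam * c * h)))) := by ring
    _ ≤ _ := by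
      gcongr
      linarith

section Front

variable {g φ : ℝ → ℝ} {u : ℝ → ℝ → ℝ} {kap h c lam b ρ L : ℝ}

/-- On the first two delay intervals the solution obeys the bound with the capped exponential
weight. -/
theorem front_bound_initial {q γ : ℝ} (hh : 0 < h) (hc : 0 < c) (hlam : 0 < lam) (hρ : 0 < ρ)
    (hu : SolvesStar g h u) (hφ : IsSemiWavefront g h c φ)
    (hL : 0 ≤ L) (hlip : ∀ v w, |g v - g w| ≤ L * |v - w|)
    (hq0 : 0 < q)
    (hq : ∀ d ≥ ρ / 4, ∀ v ∈ Icc (kap - ρ) (kap + ρ), ∀ w ∈ Icc (kap - ρ) (kap + ρ),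
      |v - w| ≤ d → |g v - g w| ≤ q * d)
    (hφnear : ∀ z, b - c * h ≤ z → |φ z - kap| ≤ ρ / 4)
    (hunear : ∀ s ∈ Icc (-h) 0, ∀ x, b - c * h ≤ x →
      |u s x - kap| ≤ ρ / 4 ∧ |φ (x + c * s) - kap| ≤ ρ / 4)
    (hclose : ∀ s ∈ Icc (-h) 0, ∀ x ≤ b,
      |u s x - φ (x + c * s)| ≤ ρ / 2 * Real.exp (lam * (x + c * s - b)))
    (hγ : 0 < γ)
    (hγ1 : γ + L * Real.exp (γ * h) * Real.exp (-(lam * c * h)) ≤ 1 + c * lam - lam ^ 2)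
    (hγ2 : q * Real.exp (γ * h) + γ ≤ 1) (hγ3 : 1 / 2 ≤ Real.exp (-(γ * h))) :
    ∀ t ∈ Icc 0 (2 * h), ∀ x, |u t x - φ (x + c * t)| ≤
      ρ / 2 * Real.exp (-(γ * t)) * barrierWeight lam b 0 (x + c * t) := by
  have hshift : ∀ t x : ℝ, x + c * (t - h) = x + c * t - c * h := fun t x => by ring
  have hbar : ∀ z : ℝ, barrierWeight lam b 0 z ≤ 1 := fun z => by
    simpa using barrierWeight_le (b := b) hlam le_rfl z
  have hright : ∀ t ≤ 2 * h, ∀ d : ℝ, ∀ z : ℝ, d ≤ q * (ρ / 2 * Real.exp (-(γ * (t - h)))) →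
      d ≤ ρ / 2 * Real.exp (-(γ * t)) *
        ((1 - γ) * (1 + 0 - 0 * Real.exp (-(lam * (z - b))))
          + 0 * lam * (lam + c) * Real.exp (-(lam * (z - b)))) := by
    intro t ht d z hd
    have h1 : Real.exp (-(γ * (t - h))) = Real.exp (-(γ * t)) * Real.exp (γ * h) := by
      rw [← Real.exp_add]; ring_nf
    rw [h1] at hd
    have h2 : 0 < Real.exp (-(γ * t)) := Real.exp_pos _
    calc d ≤ ρ / 2 * Real.exp (-(γ * t)) * (q * Real.exp (γ * h)) := by linarith
      _ ≤ ρ / 2 * Real.exp (-(γ * t)) * (1 - γ) := by gcongr; linarith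
      _ = _ := by ring
  have hfirst : ∀ t ∈ Icc 0 h, ∀ x, |u t x - φ (x + c * t)| ≤
      ρ / 2 * Real.exp (-(γ * t)) * barrierWeight lam b 0 (x + c * t) := by
    refine (stripSolution_sub_profile (t1 := h) hh hu hφ le_rfl).abs_le_barrier hlam le_rfl
      zero_le_one (by positivity) ?_ ?_ ?_
    · intro x
      have h0 : (0 : ℝ) ∈ Icc (-h) 0 := ⟨by linarith, le_rfl⟩
      simp only [mul_zero, add_zero, neg_zero, Real.exp_zero, mul_one]
      rcases le_or_gt x b with hx | hx
      · rw [barrierWeight_of_le hx]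
        simpa using hclose 0 h0 x hx
      · have hch : 0 < c * h := by positivity
        obtain ⟨h1, h2⟩ := hunear 0 h0 x (by linarith)
        rw [barrierWeight_of_lt hx]
        rw [mul_zero, add_zero, abs_le] at h2
        rw [abs_le] at h1 ⊢
        constructor <;> linarith [h1.1, h1.2, h2.1, h2.2]
    · intro t ht x hx
      refine source_le_left hL (by positivity) hγ1 (hlip _ _) ?_
      have hxb : x ≤ b := by
        have : 0 < c * t := mul_pos hc ht.1
        linarith
      have h1 := hclose (t - h) ⟨by linarith [ht.1], by linarith [ht.2]⟩ x hxb
      rw [hshift] at h1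
      refine h1.trans ?_
      have h2 : 1 ≤ Real.exp (-(γ * (t - h))) := by
        apply Real.one_le_exp
        nlinarith [ht.2]
      have h3 : ρ / 2 ≤ ρ / 2 * Real.exp (-(γ * (t - h))) :=
        le_mul_of_one_le_right (by positivity) h2
      gcongr
    · intro t ht x hx
      refine hright t (by linarith [ht.2]) _ _ ?_
      have hxb : b - c * h ≤ x := by
        have : c * t ≤ c * h := by gcongr; exact ht.2
        linarith
      obtain ⟨h1, h2⟩ := hunear (t - h) ⟨by linarith [ht.1], by linarith [ht.2]⟩ x hxb
      rw [hshift] at h2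
      have h3 : 1 ≤ Real.exp (-(γ * (t - h))) := by
        apply Real.one_le_exp
        nlinarith [ht.2]
      have h4 : |g (u (t - h) x) - g (φ (x + c * t - c * h))| ≤ q * (ρ / 2) := by
        rw [abs_le] at h1 h2
        refine hq _ (by linarith) _ ⟨?_, ?_⟩ _ ⟨?_, ?_⟩ ?_
        · linarith [h1.1]
        · linarith [h1.2]
        · linarith [h2.1]
        · linarith [h2.2]
        · rw [abs_le]
          constructor <;> linarith [h1.1, h1.2, h2.1, h2.2]
      refine h4.trans ?_
      gcongr
      exact le_mul_of_one_le_right (by positivity) h3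
  have hsecond : ∀ t ∈ Icc h (2 * h), ∀ x, |u t x - φ (x + c * t)| ≤
      ρ / 2 * Real.exp (-(γ * t)) * barrierWeight lam b 0 (x + c * t) := by
    refine (stripSolution_sub_profile (t1 := 2 * h) hh hu hφ hh.le).abs_le_barrier hlam le_rfl
      zero_le_one (by positivity) (hfirst h ⟨hh.le, le_rfl⟩) ?_ ?_
    · intro t ht x hx
      refine source_le_left hL (by positivity) hγ1 (hlip _ _) ?_
      have h1 := hfirst (t - h) ⟨by linarith [ht.1], by linarith [ht.2]⟩ x
      rw [hshift] at h1
      have hch : 0 < c * h := by positivity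
      rwa [barrierWeight_of_le (by linarith)] at h1
    · intro t ht x hx
      refine hright t ht.2 _ _ ?_
      have h1 := hfirst (t - h) ⟨by linarith [ht.1], by linarith [ht.2]⟩ x
      rw [hshift] at h1
      have h2 : |u (t - h) x - φ (x + c * t - c * h)| ≤ ρ / 2 * Real.exp (-(γ * (t - h))) :=
        h1.trans (mul_le_of_le_one_right (by positivity) (hbar _))
      have h3 : Real.exp (-(γ * (t - h))) ≤ 1 := by
        rw [Real.exp_le_one_iff]
        nlinarith [ht.1]
      have h4 : Real.exp (-(γ * h)) ≤ Real.exp (-(γ * (t - h))) := by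
        apply Real.exp_le_exp.2
        nlinarith [ht.2]
      have h5 := hφnear (x + c * t - c * h) (by linarith)
      have h6 : |u (t - h) x - φ (x + c * t - c * h)| ≤ ρ / 2 := by
        nlinarith
      refine hq _ ?_ _ ⟨?_, ?_⟩ _ ⟨?_, ?_⟩ h2
      · nlinarith
      all_goals rw [abs_le] at h5 h6; linarith [h5.1, h5.2, h6.1, h6.2]
  intro t ht x
  rcases le_total t h with h1 | h1
  · exact hfirst t ⟨ht.1, h1⟩ x
  · exact hsecond t ⟨h1, ht.2⟩ x

/-- Propagation of a bound with the strictly increasing weight to all later times. -/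
theorem front_bound_propagate {q γ A e Z : ℝ} (hh : 0 < h) (hc : 0 < c) (hlam : 0 < lam)
    (hρ : 0 < ρ) (hu : SolvesStar g h u) (hφ : IsSemiWavefront g h c φ)
    (hL : 0 ≤ L) (hlip : ∀ v w, |g v - g w| ≤ L * |v - w|)
    (hg' : ∀ v ∈ Icc (kap - ρ) (kap + ρ), DifferentiableAt ℝ g v ∧ |deriv g v| < 1)
    (hq0 : 0 < q)
    (hq : ∀ z ≥ Z, ∀ v ∈ Icc (kap - ρ) (kap + ρ),
      |g v - g (φ (z - c * h))| ≤ q * |v - φ (z - c * h)|)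
    (hφnear : ∀ z, b - c * h ≤ z → |φ z - kap| ≤ ρ / 4)
    (he0 : 0 < e) (he1 : e ≤ 1) (hA : 0 ≤ A) (hAe : A * (1 + e) ≤ ρ / 2)
    (hγ : 0 < γ)
    (hγ1 : γ + L * Real.exp (γ * h) * Real.exp (-(lam * c * h)) ≤ 1 + c * lam - lam ^ 2)
    (hγ2 : q * Real.exp (γ * h) + γ ≤ 1)
    (hγ3 : 2 * (Real.exp (γ * h) - 1 + γ) ≤
      e * lam * (lam + c) * Real.exp (-(lam * (Z - b))))
    (hstart : ∀ t ∈ Icc h (2 * h), ∀ x, |u t x - φ (x + c * t)| ≤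
      A * Real.exp (-(γ * t)) * barrierWeight lam b e (x + c * t)) :
    ∀ t ≥ h, ∀ x, |u t x - φ (x + c * t)| ≤
      A * Real.exp (-(γ * t)) * barrierWeight lam b e (x + c * t) := by
  have hshift : ∀ t x : ℝ, x + c * (t - h) = x + c * t - c * h := fun t x => by ring
  have hch : 0 < c * h := by positivity
  have hnonexp : ∀ v ∈ Icc (kap - ρ) (kap + ρ), ∀ w ∈ Icc (kap - ρ) (kap + ρ),
      |g v - g w| ≤ |v - w| := by
    intro v hv w hw
    rcases eq_or_ne v w with rfl | hne
    · simp
    · exact (abs_sub_lt_of_abs_deriv_lt_one hg' hv hw hne).le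
  have hsteps : ∀ n : ℕ, ∀ t ∈ Icc h ((n + 2) * h), ∀ x, |u t x - φ (x + c * t)| ≤
      A * Real.exp (-(γ * t)) * barrierWeight lam b e (x + c * t) := by
    intro n
    induction n with
    | zero => simpa using hstart
    | succ n ih =>
      have hn : (0 : ℝ) ≤ n := n.cast_nonneg
      have hnh : 0 ≤ n * h := by positivity
      have hnext : ∀ t ∈ Icc ((n + 2) * h) ((n + 3) * h), ∀ x, |u t x - φ (x + c * t)| ≤
          A * Real.exp (-(γ * t)) * barrierWeight lam b e (x + c * t) := by
        refine (stripSolution_sub_profile (t1 := (n + 3) * h) hh hu hφ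
          (by positivity)).abs_le_barrier hlam he0.le he1 hA
          (ih _ ⟨by linarith, le_rfl⟩) ?_ ?_
        · intro t ht x hx
          refine source_le_left hL hA hγ1 (hlip _ _) ?_
          have h1 := ih (t - h) ⟨by linarith [ht.1], by linarith [ht.2]⟩ x
          rw [hshift] at h1
          rwa [barrierWeight_of_le (by linarith)] at h1
        · intro t ht x hx
          have hth : h ≤ t - h := by linarith [ht.1]
          have h1 := ih (t - h) ⟨hth, by linarith [ht.2]⟩ x
          rw [hshift] at h1
          set z := x + c * t with hz
          have hexp : Real.exp (-(γ * (t - h))) = Real.exp (-(γ * t)) * Real.exp (γ * h) := by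
            rw [← Real.exp_add]; ring_nf
          have hexp1 : Real.exp (-(γ * (t - h))) ≤ 1 := by
            rw [Real.exp_le_one_iff]
            nlinarith
          have hsmall : |u (t - h) x - φ (z - c * h)| ≤ ρ / 2 := by
            refine h1.trans (le_trans ?_ hAe)
            have h2 := barrierWeight_le (b := b) hlam he0.le (z - c * h)
            exact mul_le_mul (mul_le_of_le_one_right hA hexp1) h2
              (barrierWeight_pos hlam he0.le _).le hA
          have hφz := hφnear (z - c * h) (by linarith)
          have hφmem : φ (z - c * h) ∈ Icc (kap - ρ) (kap + ρ) := by
            rw [abs_le] at hφz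
            constructor <;> linarith [hφz.1, hφz.2]
          have humem : u (t - h) x ∈ Icc (kap - ρ) (kap + ρ) := by
            rw [abs_le] at hφz hsmall
            constructor <;> linarith [hφz.1, hφz.2, hsmall.1, hsmall.2]
          set Y := Real.exp (-(lam * (z - b))) with hY
          have hYpos : 0 < Y := Real.exp_pos _
          have hw : barrierWeight lam b e z = 1 + e - e * Y := barrierWeight_of_lt hx
          have hwpos : 0 < 1 + e - e * Y := hw ▸ barrierWeight_pos hlam he0.le z
          have hwle : 1 + e - e * Y ≤ 2 := by nlinarith
          have h3 : |u (t - h) x - φ (z - c * h)| ≤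
              A * Real.exp (-(γ * t)) * (Real.exp (γ * h) * (1 + e - e * Y)) := by
            calc _ ≤ A * (Real.exp (-(γ * t)) * Real.exp (γ * h)) * barrierWeight lam b e z := by
                  rw [← hexp]
                  refine h1.trans ?_
                  gcongr
                  exact barrierWeight_mono hlam he0.le (by linarith)
              _ = _ := by rw [hw]; ring
          have hG1 : 1 ≤ Real.exp (γ * h) := Real.one_le_exp (by positivity)
          rcases le_or_gt Z z with hZ | hZ
          · calc _ ≤ q * |u (t - h) x - φ (z - c * h)| := hq z hZ _ humem
              _ ≤ q * (A * Real.exp (-(γ * t)) * (Real.exp (γ * h) * (1 + e - e * Y))) := by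
                gcongr
              _ = A * Real.exp (-(γ * t)) * ((q * Real.exp (γ * h)) * (1 + e - e * Y)) := by ring
              _ ≤ A * Real.exp (-(γ * t)) * ((1 - γ) * (1 + e - e * Y)
                    + e * lam * (lam + c) * Y) := by
                have h5 : 0 ≤ e * lam * (lam + c) * Y := by positivity
                have h6 : q * Real.exp (γ * h) * (1 + e - e * Y) ≤ (1 - γ) * (1 + e - e * Y) := by
                  gcongr
                  linarith
                gcongr
                linarith
          · have hYZ : Real.exp (-(lam * (Z - b))) ≤ Y := by
              apply Real.exp_le_exp.2
              have : lam * (z - b) ≤ lam * (Z - b) := by gcongr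
              linarith
            refine ((hnonexp _ humem _ hφmem).trans h3).trans ?_
            have h5 : e * lam * (lam + c) * Real.exp (-(lam * (Z - b))) ≤
                e * lam * (lam + c) * Y := by gcongr
            have h6 : (Real.exp (γ * h) - 1 + γ) * (1 + e - e * Y) ≤
                (Real.exp (γ * h) - 1 + γ) * 2 := by
              gcongr
            gcongr
            linarith
      intro t ht x
      rcases le_total t ((n + 2) * h) with h1 | h1
      · exact ih t ⟨ht.1, h1⟩ x
      · refine hnext t ⟨h1, ?_⟩ x
        have := ht.2
        push_cast at this
        linarith
  intro t ht x
  obtain ⟨n, hn⟩ := exists_nat_ge (t / h)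
  refine hsteps n t ⟨ht, ?_⟩ x
  rw [div_le_iff₀ hh] at hn
  linarith

end Front

/-- Finitely many strict inequalities at `0` persist for some small positive parameter; the form
in which the decay rates are chosen. -/
theorem exists_pos_small_rate {h K K' q C0 C1 m : ℝ} (hK : K < K') (hq : q < 1)
    (h01 : 0 < C1) (hm : 0 < m) (h0 : C0 < 1) :
    ∃ γ, 0 < γ ∧ γ ≤ m ∧ γ + K * Real.exp (γ * h) ≤ K' ∧ q * Real.exp (γ * h) + γ ≤ 1 ∧
      2 * (Real.exp (γ * h) - 1 + γ) ≤ C1 ∧ C0 ≤ Real.exp (-(γ * h)) := by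
  have hev : ∀ {f : ℝ → ℝ} {k : ℝ}, Continuous f → f 0 < k →
      ∀ᶠ γ in nhdsWithin (0 : ℝ) (Ioi 0), f γ < k := fun hf h =>
    nhdsWithin_le_nhds (hf.continuousAt.eventually_lt_const h)
  have e1 := hev (f := fun γ => γ) (k := m) (by fun_prop) hm
  have e2 := hev (f := fun γ => γ + K * Real.exp (γ * h)) (k := K') (by fun_prop) (by simpa)
  have e3 := hev (f := fun γ => q * Real.exp (γ * h) + γ) (k := 1) (by fun_prop) (by simpa)
  have e4 := hev (f := fun γ => 2 * (Real.exp (γ * h) - 1 + γ)) (k := C1) (by fun_prop)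
    (by simpa)
  have e5 := hev (f := fun γ => -Real.exp (-(γ * h))) (k := -C0) (by fun_prop) (by simpa)
  obtain ⟨γ, h1, h2, h3, h4, h5, h6⟩ :=
    (e1.and (e2.and (e3.and (e4.and (e5.and self_mem_nhdsWithin))))).exists
  exact ⟨γ, h6, h1.le, h2.le, h3.le, h4.le, by linarith⟩

/-- **Theorem 3B (global stability near κ for possibly non-monotone `g`).**
Under (UM) and `|g'| < 1` on `[κ−ρ, κ+ρ]`, if the initial datum stays in
`[κ−ρ/4, κ+ρ/4]` together with the profile for `x ≥ b − ch` and is `0.5ρ e^{λ(x+cs−b)}`-close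
to the profile for `x ≤ b`, then the semi-wavefront is a wavefront and the solution
converges to it exponentially in the `η_λ`-weighted norm. -/
theorem semi_wavefront_is_wavefront_and_stable
    (g : ℝ → ℝ) (kap del0 Lg h c : ℝ)
    -- (UM): (H), L_g = g'(0), g bounded
    (hH : HypH g kap del0 Lg) (hLg : Lg = deriv g 0)
    (hbdd : ∃ M : ℝ, ∀ x : ℝ, 0 ≤ x → g x ≤ M)
    (hh : 0 < h) (hc : 0 < c)
    (w0 : ℝ → ℝ → ℝ) (hIC1 : IC1 h w0)
    -- c > c_# : χ₀(·;c) has two distinct positive real zeros λ₁ < λ₂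
    (lam1 lam2 : ℝ) (hlam1_pos : 0 < lam1) (hlam_lt : lam1 < lam2)
    (hchi1 : chi (deriv g 0) c h lam1 = 0) (hchi2 : chi (deriv g 0) c h lam2 = 0)
    (lam : ℝ) (hlam : lam ∈ Set.Ioo lam1 lam2)
    (φ : ℝ → ℝ) (hφ : IsSemiWavefront g h c φ)
    -- |g'(u)| < 1 on [κ−ρ, κ+ρ]
    (ρ : ℝ) (hρ : 0 < ρ)
    (hg' : ∀ v ∈ Set.Icc (kap - ρ) (kap + ρ),
        DifferentiableAt ℝ g v ∧ |deriv g v| < 1)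
    (b : ℝ) (hb : 0 ≤ b)
    -- (i): w₀ and φ stay in [κ−ρ/4, κ+ρ/4] for x ≥ b − ch
    (hnear : ∀ x : ℝ, b - c * h ≤ x → ∀ s ∈ Set.Icc (-h) 0,
        kap - ρ / 4 ≤ w0 s x ∧ w0 s x ≤ kap + ρ / 4 ∧
        kap - ρ / 4 ≤ φ (x + c * s) ∧ φ (x + c * s) ≤ kap + ρ / 4)
    -- (ii): |w₀(s,x) − φ(x+cs)| ≤ 0.5ρ e^{λ(x+cs−b)} for x ≤ b
    (hclose : ∀ x : ℝ, x ≤ b → ∀ s ∈ Set.Icc (-h) 0,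
        |w0 s x - φ (x + c * s)| ≤ 0.5 * ρ * Real.exp (lam * (x + c * s - b)))
    -- u : a classical solution of (*) with initial datum w₀
    (u : ℝ → ℝ → ℝ) (hu : SolvesStar g h u)
    (hinit : ∀ s ∈ Set.Icc (-h) 0, ∀ x : ℝ, u s x = w0 s x) :
    Filter.Tendsto φ Filter.atTop (nhds kap) ∧
    ∃ γ > (0:ℝ), ∀ t ≥ (0:ℝ), ∀ x : ℝ,
      |u t x - φ (x + c * t)| ≤ 0.5 * ρ * Real.exp (-(γ * t)) * eta lam (x + c * t) := by
  have hL : 0 < deriv g 0 := by linarith [hH.deriv0_gt]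
  have hlam0 : 0 < lam := hlam1_pos.trans hlam.1
  have hlip : ∀ v w, |g v - g w| ≤ deriv g 0 * |v - w| := fun v w => by
    have := hH.lipschitz_all hLg v w
    rwa [hLg] at this
  have hgk : g kap = kap := (hH.fixed_points kap hH.kap_pos.le).2 (Or.inr rfl)
  have hsmooth : ContDiffAt ℝ 1 g kap :=
    hH.smooth_kap.contDiffAt (Ioo_mem_nhds (by linarith [hH.del0_pos]) (by linarith [hH.del0_pos]))
  have hch : 0 < c * h := by positivity
  have hφnear : ∀ z, b - c * h ≤ z → |φ z - kap| ≤ ρ / 4 := by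
    intro z hz
    obtain ⟨-, -, h1, h2⟩ := hnear z hz 0 ⟨by linarith, le_rfl⟩
    rw [mul_zero, add_zero] at h1 h2
    rw [abs_le]
    constructor <;> linarith
  have hφlim : Tendsto φ atTop (nhds kap) := by
    obtain ⟨-, -, hφ2, hφeq, -, -⟩ := hφ
    refine profile_tendsto_of_contraction hc hρ hgk hg'
      (fun z => (hφ2.differentiable (by norm_num) z).hasDerivAt)
      (fun z => (hφ2.differentiable_deriv_two z).hasDerivAt) hφeq ?_
    filter_upwards [eventually_ge_atTop (b - c * h)] with z hz
    linarith [hφnear z hz]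
  refine ⟨hφlim, ?_⟩
  have hchi : deriv g 0 * Real.exp (-(lam * c * h)) < 1 + c * lam - lam ^ 2 := by
    have := chi_neg_of_between hL hchi1 hchi2 hlam
    linarith
  obtain ⟨q1, hq10, hq11, hq1⟩ := exists_modulus_contraction hg' (d0 := ρ / 4) (by positivity)
  obtain ⟨r, hr, q2, hq20, hq21, hq2⟩ := exists_contraction_near_fixed_point hρ hsmooth hg'
  obtain ⟨Z0, hZ0⟩ := Metric.tendsto_atTop.1 hφlim r hr
  set Z : ℝ := max b (Z0 + c * h) with hZ
  have hq2' : ∀ z ≥ Z, ∀ v ∈ Icc (kap - ρ) (kap + ρ),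
      |g v - g (φ (z - c * h))| ≤ q2 * |v - φ (z - c * h)| := by
    intro z hz v hv
    have h1 : b ≤ z := (le_max_left _ _).trans hz
    have h2 : Z0 + c * h ≤ z := (le_max_right _ _).trans hz
    have h3 := hφnear (z - c * h) (by linarith)
    have h4 := hZ0 (z - c * h) (by linarith)
    rw [Real.dist_eq] at h4
    rw [abs_le] at h3
    rw [abs_sub_comm, abs_sub_comm v]
    exact hq2 _ ⟨by linarith, by linarith⟩ v hv h4.le
  obtain ⟨γ, hγ0, -, hγ1, hγ2, -, hγ3⟩ := exists_pos_small_rate (h := h) (C0 := 1 / 2) hchi hq11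
    one_pos one_pos (by norm_num)
  have hinitial := front_bound_initial hh hc hlam0 hρ hu hφ hL.le hlip hq10 hq1 hφnear
    (fun s hs x hx => by
      obtain ⟨h1, h2, h3, h4⟩ := hnear x hx s hs
      rw [hinit s hs x, abs_le, abs_le]
      refine ⟨⟨?_, ?_⟩, ?_, ?_⟩ <;> linarith)
    (fun s hs x hx => by
      rw [hinit s hs x]
      refine (hclose x hx s hs).trans_eq ?_
      ring)
    hγ0 (by linarith) hγ2 hγ3
  set e : ℝ := min 1 (Real.exp (γ * h / 2) - 1) with he
  have he0 : 0 < e := lt_min one_pos (sub_pos.2 (Real.one_lt_exp_iff.2 (by positivity)))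
  have he1 : e ≤ 1 := min_le_left _ _
  have he2 : 1 + e ≤ Real.exp (γ * h / 2) := by
    have := min_le_right 1 (Real.exp (γ * h / 2) - 1)
    linarith
  obtain ⟨γ', hγ'0, hγ'm, hγ'1, hγ'2, hγ'3, -⟩ := exists_pos_small_rate (h := h) (C0 := 0) hchi hq21
    (show 0 < e * lam * (lam + c) * Real.exp (-(lam * (Z - b))) by positivity)
    (half_pos hγ0) one_pos
  set A : ℝ := ρ / 2 * Real.exp (-((γ - γ') * h)) with hA
  have hApos : 0 < A := by positivity
  have hAe : A * (1 + e) ≤ ρ / 2 := by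
    have h1 : Real.exp (-((γ - γ') * h)) * Real.exp (γ * h / 2) ≤ 1 := by
      rw [← Real.exp_add, Real.exp_le_one_iff]
      nlinarith
    calc A * (1 + e) ≤ ρ / 2 * Real.exp (-((γ - γ') * h)) * Real.exp (γ * h / 2) := by gcongr
      _ = ρ / 2 * (Real.exp (-((γ - γ') * h)) * Real.exp (γ * h / 2)) := by ring
      _ ≤ ρ / 2 := mul_le_of_le_one_right (by positivity) h1
  have hlater := front_bound_propagate hh hc hlam0 hρ hu hφ hL.le hlip hg' hq20 hq2' hφnear
    he0 he1 hApos.le hAe hγ'0 (by linarith) hγ'2 hγ'3 (fun t ht x => by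
      refine (hinitial t ⟨by linarith [ht.1], ht.2⟩ x).trans ?_
      have h1 : Real.exp (-(γ * t)) ≤ Real.exp (-((γ - γ') * h)) * Real.exp (-(γ' * t)) := by
        rw [← Real.exp_add]
        apply Real.exp_le_exp.2
        nlinarith [ht.1]
      have h2 := barrierWeight_zero_le (b := b) hlam0 he0.le (x + c * t)
      have h3 := (barrierWeight_pos (b := b) hlam0 le_rfl (x + c * t)).le
      rw [hA, mul_assoc (ρ / 2) (Real.exp (-((γ - γ') * h)))]
      gcongr)
  refine ⟨γ', hγ'0, fun t ht x => ?_⟩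
  have heta := barrierWeight_zero_le_eta hlam0 hb (x + c * t)
  have hpos := (barrierWeight_pos (b := b) hlam0 le_rfl (x + c * t)).le
  rw [show (0.5 : ℝ) * ρ = ρ / 2 by ring]
  rcases le_total t h with hth | hth
  · refine (hinitial t ⟨ht, by linarith⟩ x).trans ?_
    have h1 : γ' * t ≤ γ * t := by
      gcongr
      linarith
    gcongr
  · refine (hlater t hth x).trans ?_
    have h1 := barrierWeight_le_mul_zero (b := b) hlam0 he0.le (x + c * t)
    calc A * Real.exp (-(γ' * t)) * barrierWeight lam b e (x + c * t)
        ≤ A * Real.exp (-(γ' * t)) * ((1 + e) * barrierWeight lam b 0 (x + c * t)) := by gcongr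
      _ = A * (1 + e) * Real.exp (-(γ' * t)) * barrierWeight lam b 0 (x + c * t) := by ring
      _ ≤ ρ / 2 * Real.exp (-(γ' * t)) * eta lam (x + c * t) := by gcongr

end
end
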